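/- Let n ≥ 1, 0 < s < 1, 1 ≤ p < ∞, and let F be a finite-dimensional real inner product space. There exists a constant C = C(n,s,p) > 0 (independent of R) such that for every 0 < R < ∞, every connection form Γ ∈ C¹ on cl(B_{2R}) × [0,R] ⊆ ℝ^{n+1} with values in L(ℝ^{n+1}, o(F)), every β with ‖K_Γ‖_{L∞(B_{2R}×(0,R))} + 1/R² ≤ β < ∞, and every C¹ map u : cl(B_{2R}) → F, there exists U : cl(B_R) × [0,R] → F which is C¹ on B_R × (0,R), continuous on cl(B_R) × [0,R], satisfies U(x,0) = u(x) for all x ∈ B_R, and satisfies both ∫_{B_R×(0,R)} ‖D_Γ U(z)‖^p / z_{n+1}^{1−(1−s)p} dz ≤ C (∬_{B_{2R}×B_{2R}} ‖u(x) − R^{Γ∥}(x,y) u(y)‖^p / |x−y|^{n+sp} dx dy + β^{sp/2} ∫_{B_{2R}} ‖u(x)‖^p dx) and ∫_{B_R×(0,R)} ‖U(z)‖^p / z_{n+1}^{1−(1−s)p} dz ≤ (C / β^{(1−s)p/2}) ∫_{B_{2R}} ‖u(x)‖^p dx. -/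

import Mathlib

set_option synthInstance.maxHeartbeats 1000000
set_option maxHeartbeats 1000000

open Set MeasureTheory Metric
open scoped RealInnerProductSpace ENNReal

/-- The point `(x, t) ∈ ℝⁿ × ℝ ≅ ℝ^{n+1}`. -/
noncomputable def emb {n : ℕ} (x : EuclideanSpace ℝ (Fin n)) (t : ℝ) :
    EuclideanSpace ℝ (Fin (n + 1)) :=
  (EuclideanSpace.equiv (Fin (n + 1)) ℝ).symm
    (Fin.snoc ((EuclideanSpace.equiv (Fin n) ℝ) x) t)

/-- The Hilbert–Schmidt (Frobenius) norm of a continuous linear map from `ℝ^m` to `F`. -/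
noncomputable def hsNorm {m : ℕ} {F : Type*} [NormedAddCommGroup F] [InnerProductSpace ℝ F]
    (T : EuclideanSpace ℝ (Fin m) →L[ℝ] F) : ℝ :=
  Real.sqrt (∑ i : Fin m, ‖T (EuclideanSpace.single i (1 : ℝ))‖ ^ 2)

/-- The cylinder `cl(B_r) × [0, R] ⊆ ℝ^{n+1}`. -/
def closedCylinder (n : ℕ) (r R : ℝ) : Set (EuclideanSpace ℝ (Fin (n + 1))) :=
  {z | ∃ x ∈ closedBall (0 : EuclideanSpace ℝ (Fin n)) r, ∃ t ∈ Icc (0:ℝ) R, z = emb x t}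

/-- The open cylinder `B_r × (0, R) ⊆ ℝ^{n+1}`. -/
def openCylinder (n : ℕ) (r R : ℝ) : Set (EuclideanSpace ℝ (Fin (n + 1))) :=
  {z | ∃ x ∈ ball (0 : EuclideanSpace ℝ (Fin n)) r, ∃ t ∈ Ioo (0:ℝ) R, z = emb x t}

section ODE

set_option linter.unusedSectionVars false
set_option maxSynthPendingDepth 3

variable {F : Type*} [NormedAddCommGroup F] [InnerProductSpace ℝ F] [FiniteDimensional ℝ F]
  [CompleteSpace F]

/-- `P` solves the transport equation with coefficient `A` and `P 1 = 1`. -/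
def Sol (A P : ℝ → F →L[ℝ] F) : Prop :=
  P 1 = 1 ∧ ∀ t ∈ Icc (0:ℝ) 1, HasDerivWithinAt P (-(A t * P t)) (Icc (0:ℝ) 1) t

/-- Skew-adjointness. -/
def Skew (A : ℝ → F →L[ℝ] F) : Prop :=
  ∀ t ∈ Icc (0:ℝ) 1, ∀ u w : F, ⟪A t u, w⟫ = -⟪u, A t w⟫

/-- Adjoint. -/
noncomputable def adj (T : F →L[ℝ] F) : F →L[ℝ] F := ContinuousLinearMap.adjoint T

lemma adj_mul (S T : F →L[ℝ] F) : adj (S * T) = adj T * adj S :=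
  ContinuousLinearMap.adjoint_comp S T

lemma adj_one : adj (1 : F →L[ℝ] F) = 1 := by
  unfold adj
  symm
  rw [ContinuousLinearMap.eq_adjoint_iff]
  intro x y
  rfl

lemma norm_adj (S : F →L[ℝ] F) : ‖adj S‖ = ‖S‖ := by
  simp [adj]

lemma adj_add (S T : F →L[ℝ] F) : adj (S + T) = adj S + adj T := by
  simp [adj]

lemma adj_neg (S : F →L[ℝ] F) : adj (-S) = -adj S := by
  simp [adj]

lemma adj_smul (c : ℝ) (S : F →L[ℝ] F) : adj (c • S) = c • adj S := by
  simp [adj]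

/-- Adjoint as a continuous linear map. -/
noncomputable def adjL : (F →L[ℝ] F) →L[ℝ] (F →L[ℝ] F) :=
  LinearMap.mkContinuous
    { toFun := adj, map_add' := adj_add, map_smul' := adj_smul } 1
    (fun x => by simp [norm_adj])

lemma adjL_apply (S : F →L[ℝ] F) : adjL S = adj S := rfl

lemma hasDeriv_adj {P : ℝ → F →L[ℝ] F} {P' : F →L[ℝ] F} {s : Set ℝ} {t : ℝ}
    (h : HasDerivWithinAt P P' s t) : HasDerivWithinAt (fun t => adj (P t)) (adj P') s t :=
  (adjL (F := F)).hasFDerivAt.comp_hasDerivWithinAt t h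

lemma continuousOn_adj {X : Type*} [TopologicalSpace X] {P : X → F →L[ℝ] F} {s : Set X}
    (h : ContinuousOn P s) : ContinuousOn (fun t => adj (P t)) s :=
  (adjL (F := F)).continuous.comp_continuousOn h

lemma adj_of_skew {A : ℝ → F →L[ℝ] F} (hA : Skew A) {t : ℝ} (ht : t ∈ Icc (0:ℝ) 1) :
    adj (A t) = - A t := by
  symm
  unfold adj
  rw [ContinuousLinearMap.eq_adjoint_iff]
  intro x y
  have := hA t ht x y
  simp [this]

lemma Sol.continuousOn {A P : ℝ → F →L[ℝ] F} (h : Sol A P) : ContinuousOn P (Icc (0:ℝ) 1) :=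
  fun t ht => (h.2 t ht).continuousWithinAt

lemma Sol.hasDeriv_adj_mul {A₁ P₁ A₂ P₂ : ℝ → F →L[ℝ] F} (h₁ : Sol A₁ P₁) (h₂ : Sol A₂ P₂)
    (hA : Skew A₁) {t : ℝ} (ht : t ∈ Icc (0:ℝ) 1) :
    HasDerivWithinAt (fun t => adj (P₁ t) * P₂ t) (adj (P₁ t) * (A₁ t - A₂ t) * P₂ t)
      (Icc (0:ℝ) 1) t := by
  have := (hasDeriv_adj (h₁.2 t ht)).mul (h₂.2 t ht)
  have e : adj (-(A₁ t * P₁ t)) * P₂ t + adj (P₁ t) * -(A₂ t * P₂ t)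
      = adj (P₁ t) * (A₁ t - A₂ t) * P₂ t := by
    rw [adj_neg, adj_mul, adj_of_skew hA ht]
    noncomm_ring
  rw [e] at this
  exact this

lemma Sol.adj_mul_self {A P : ℝ → F →L[ℝ] F} (h : Sol A P) (hA : Skew A)
    {t : ℝ} (ht : t ∈ Icc (0:ℝ) 1) : adj (P t) * P t = 1 := by
  have hd : ∀ t ∈ Icc (0:ℝ) 1, HasDerivWithinAt (fun t => adj (P t) * P t) 0 (Icc (0:ℝ) 1) t := by
    intro t ht
    have := h.hasDeriv_adj_mul h hA ht
    simpa using this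
  have hc := constant_of_has_deriv_right_zero (f := fun t => adj (P t) * P t) (a := 0) (b := 1)
    (fun t ht => (hd t ht).continuousWithinAt)
    (fun t ht => (hd t (Ico_subset_Icc_self ht)).mono_of_mem_nhdsWithin
      (Icc_mem_nhdsGE_of_mem ht))
  have h1 := hc 1 (by simp)
  have h2 := hc t ht
  rw [h2, ← h1, h.1, adj_one, one_mul]

lemma Sol.self_mul_adj {A P : ℝ → F →L[ℝ] F} (h : Sol A P) (hA : Skew A)
    {t : ℝ} (ht : t ∈ Icc (0:ℝ) 1) : P t * adj (P t) = 1 := by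
  have h1 := h.adj_mul_self hA ht
  have h2 : (adj (P t) : F →ₗ[ℝ] F) * (P t : F →ₗ[ℝ] F) = 1 := by
    ext x
    exact DFunLike.congr_fun h1 x
  have h3 := mul_eq_one_comm.mp h2
  ext x
  exact DFunLike.congr_fun h3 x

lemma Sol.norm_apply {A P : ℝ → F →L[ℝ] F} (h : Sol A P) (hA : Skew A)
    {t : ℝ} (ht : t ∈ Icc (0:ℝ) 1) (w : F) : ‖P t w‖ = ‖w‖ := by
  have h1 := h.adj_mul_self hA ht
  have h2 : ⟪P t w, P t w⟫ = ⟪w, w⟫ := by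
    rw [← ContinuousLinearMap.adjoint_inner_left]
    have : (ContinuousLinearMap.adjoint (P t)) ((P t) w) = w := DFunLike.congr_fun h1 w
    rw [this]
  rw [real_inner_self_eq_norm_sq, real_inner_self_eq_norm_sq] at h2
  exact (sq_eq_sq₀ (norm_nonneg _) (norm_nonneg _)).mp h2

lemma Sol.norm_le {A P : ℝ → F →L[ℝ] F} (h : Sol A P) (hA : Skew A)
    {t : ℝ} (ht : t ∈ Icc (0:ℝ) 1) : ‖P t‖ ≤ 1 :=
  ContinuousLinearMap.opNorm_le_bound _ zero_le_one (fun w => by rw [h.norm_apply hA ht, one_mul])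

lemma norm_mul_mul_le {a b c : F →L[ℝ] F} {k : ℝ} (ha : ‖a‖ ≤ 1) (hc : ‖c‖ ≤ 1) (hb : ‖b‖ ≤ k) :
    ‖a * b * c‖ ≤ k := by
  have hk : 0 ≤ k := (norm_nonneg b).trans hb
  calc ‖a * b * c‖ ≤ ‖a‖ * ‖b‖ * ‖c‖ := (norm_mul_le _ _).trans (by gcongr; exact norm_mul_le _ _)
    _ ≤ 1 * k * 1 := by gcongr
    _ = k := by ring

lemma Sol.diff {A₁ P₁ A₂ P₂ : ℝ → F →L[ℝ] F} (h₁ : Sol A₁ P₁) (h₂ : Sol A₂ P₂)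
    (hA : Skew A₁) (hc₁ : ContinuousOn A₁ (Icc 0 1)) (hc₂ : ContinuousOn A₂ (Icc 0 1))
    {t : ℝ} (ht : t ∈ Icc (0:ℝ) 1) :
    P₂ t - P₁ t = P₁ t * ∫ σ in t..1, adj (P₁ σ) * (A₂ σ - A₁ σ) * P₂ σ := by
  have hco : ContinuousOn (fun σ => adj (P₁ σ) * (A₁ σ - A₂ σ) * P₂ σ) (Icc 0 1) :=
    ((continuousOn_adj h₁.continuousOn).mul (hc₁.sub hc₂)).mul h₂.continuousOn
  have hsub : Icc t 1 ⊆ Icc 0 1 := Icc_subset_Icc_left ht.1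
  have := intervalIntegral.integral_eq_sub_of_hasDerivAt_of_le (a := t) (b := 1) ht.2
    (f := fun t => adj (P₁ t) * P₂ t) (f' := fun σ => adj (P₁ σ) * (A₁ σ - A₂ σ) * P₂ σ)
    (((continuousOn_adj h₁.continuousOn).mul h₂.continuousOn).mono hsub)
    (fun x hx => (h₁.hasDeriv_adj_mul h₂ hA (hsub (Ioo_subset_Icc_self hx))).hasDerivAt
      (Icc_mem_nhds (ht.1.trans_lt hx.1) hx.2))
    (ContinuousOn.intervalIntegrable_of_Icc ht.2 (hco.mono hsub))
  have h4 : (∫ σ in t..1, adj (P₁ σ) * (A₂ σ - A₁ σ) * P₂ σ)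
      = - ∫ σ in t..1, adj (P₁ σ) * (A₁ σ - A₂ σ) * P₂ σ := by
    rw [← intervalIntegral.integral_neg]
    congr 1
    ext1 σ
    noncomm_ring
  rw [h4, this, h₁.1, h₂.1, adj_one]
  have := h₁.self_mul_adj hA ht
  calc P₂ t - P₁ t = (P₁ t * adj (P₁ t)) * P₂ t - P₁ t := by rw [this, one_mul]
    _ = _ := by noncomm_ring

lemma Sol.lip {A₁ P₁ A₂ P₂ : ℝ → F →L[ℝ] F} (h₁ : Sol A₁ P₁) (h₂ : Sol A₂ P₂)
    (hA : Skew A₁) (hA₂ : Skew A₂)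
    (hc₁ : ContinuousOn A₁ (Icc 0 1)) (hc₂ : ContinuousOn A₂ (Icc 0 1))
    {ε : ℝ} (hε : ∀ σ ∈ Icc (0:ℝ) 1, ‖A₂ σ - A₁ σ‖ ≤ ε)
    {t : ℝ} (ht : t ∈ Icc (0:ℝ) 1) : ‖P₂ t - P₁ t‖ ≤ ε := by
  have hε0 : 0 ≤ ε := (norm_nonneg _).trans (hε 0 (by simp))
  rw [h₁.diff h₂ hA hc₁ hc₂ ht]
  have : ‖∫ σ in t..1, adj (P₁ σ) * (A₂ σ - A₁ σ) * P₂ σ‖ ≤ ε * |1 - t| := by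
    apply intervalIntegral.norm_integral_le_of_norm_le_const
    intro σ hσ
    rw [uIoc_of_le ht.2] at hσ
    have hσ' : σ ∈ Icc (0:ℝ) 1 := ⟨ht.1.trans hσ.1.le, hσ.2⟩
    exact norm_mul_mul_le (by rw [norm_adj]; exact h₁.norm_le hA hσ') (h₂.norm_le hA₂ hσ')
      (hε σ hσ')
  have h3 : |1 - t| ≤ 1 := by rw [abs_of_nonneg] <;> linarith [ht.1, ht.2]
  calc _ ≤ ‖P₁ t‖ * ‖∫ σ in t..1, adj (P₁ σ) * (A₂ σ - A₁ σ) * P₂ σ‖ := norm_mul_le _ _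
    _ ≤ 1 * (ε * 1) := by
        gcongr
        · exact h₁.norm_le hA ht
        · exact this.trans (by gcongr)
    _ = ε := by ring

lemma Sol.unique {A P₁ P₂ : ℝ → F →L[ℝ] F} (h₁ : Sol A P₁) (h₂ : Sol A P₂)
    (hA : Skew A) (hc : ContinuousOn A (Icc 0 1)) {t : ℝ} (ht : t ∈ Icc (0:ℝ) 1) :
    P₂ t = P₁ t := by
  have := h₁.lip h₂ hA hA hc hc (ε := 0) (fun σ _ => by simp) ht
  simpa [sub_eq_zero] using this

/-- Radial truncation. -/
noncomputable def trunc {W : Type*} [NormedAddCommGroup W] [NormedSpace ℝ W] (x : W) : W :=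
  (max 1 ‖x‖)⁻¹ • x

lemma norm_trunc {W : Type*} [NormedAddCommGroup W] [NormedSpace ℝ W] (x : W) :
    ‖trunc x‖ ≤ 1 := by
  unfold trunc
  have h0 : (0:ℝ) < max 1 ‖x‖ := lt_max_of_lt_left one_pos
  rw [norm_smul, norm_inv, Real.norm_of_nonneg h0.le, inv_mul_le_iff₀ h0]
  simp

lemma trunc_lip {W : Type*} [NormedAddCommGroup W] [NormedSpace ℝ W] (x y : W) :
    ‖trunc x - trunc y‖ ≤ 2 * ‖x - y‖ := by
  unfold trunc
  set a := max 1 ‖x‖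
  set b := max 1 ‖y‖
  have ha : 1 ≤ a := le_max_left _ _
  have hb : 1 ≤ b := le_max_left _ _
  have hyb : ‖y‖ ≤ b := le_max_right _ _
  have hab : |a - b| ≤ ‖x - y‖ :=
    (by simpa [a, b, max_comm] using abs_max_sub_max_le_abs ‖x‖ ‖y‖ 1 :
      |a - b| ≤ |‖x‖ - ‖y‖|).trans (abs_norm_sub_norm_le x y)
  have e : a⁻¹ • x - b⁻¹ • y = a⁻¹ • (x - y) + (a⁻¹ * (b - a) * b⁻¹) • y := by
    have : a⁻¹ * (b - a) * b⁻¹ = a⁻¹ - b⁻¹ := by field_simp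
    rw [this]; module
  rw [e]
  refine (norm_add_le _ _).trans ?_
  rw [norm_smul, norm_smul, norm_mul, norm_mul, norm_inv, norm_inv,
    Real.norm_of_nonneg (by linarith : (0:ℝ) ≤ a), Real.norm_of_nonneg (by linarith : (0:ℝ) ≤ b),
    Real.norm_eq_abs, abs_sub_comm]
  have ha' : a⁻¹ ≤ 1 := inv_le_one_of_one_le₀ ha
  have h2 : b⁻¹ * ‖y‖ ≤ 1 := by rw [inv_mul_le_iff₀ (by linarith)]; linarith
  have h3 : 0 ≤ b⁻¹ * ‖y‖ := by positivity
  calc a⁻¹ * ‖x - y‖ + a⁻¹ * |a - b| * b⁻¹ * ‖y‖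
      = a⁻¹ * ‖x - y‖ + a⁻¹ * |a - b| * (b⁻¹ * ‖y‖) := by ring
    _ ≤ 1 * ‖x - y‖ + 1 * ‖x - y‖ * 1 := by gcongr
    _ = 2 * ‖x - y‖ := by ring

lemma exists_Sol {A : ℝ → F →L[ℝ] F} (hA : Skew A) (hc : ContinuousOn A (Icc 0 1)) :
    ∃ P, Sol A P := by
  obtain ⟨M, hM⟩ := (isCompact_Icc (a := (0:ℝ)) (b := 1)).exists_bound_of_continuousOn hc
  have hM0 : 0 ≤ M := (norm_nonneg _).trans (hM 0 (by simp))
  let N : NNReal := ⟨M, hM0⟩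
  have hN : (N : ℝ) = M := rfl
  have hPL : IsPicardLindelof (fun t (P : F →L[ℝ] F) => -(A t * trunc P)) (tmin := 0) (tmax := 1)
      ⟨1, by simp⟩ 1 N 0 N (2 * N) := by
    constructor
    · intro t ht
      apply LipschitzOnWith.of_dist_le_mul
      intro x _ y _
      rw [dist_eq_norm, dist_eq_norm]
      have : -(A t * trunc x) - -(A t * trunc y) = -(A t * (trunc x - trunc y)) := by noncomm_ring
      rw [this, norm_neg]
      calc _ ≤ ‖A t‖ * ‖trunc x - trunc y‖ := norm_mul_le _ _
        _ ≤ M * (2 * ‖x - y‖) := by gcongr; exacts [hM t ht, trunc_lip x y]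
        _ = _ := by rw [NNReal.coe_mul, hN]; simp; ring
    · intro x _
      exact (hc.mul continuousOn_const).neg
    · intro t ht x _
      rw [norm_neg]
      calc _ ≤ ‖A t‖ * ‖trunc x‖ := norm_mul_le _ _
        _ ≤ M * 1 := by gcongr; exacts [hM t ht, norm_trunc x]
        _ = _ := by rw [hN, mul_one]
    · simp
  obtain ⟨P, hP1, hP⟩ := hPL.exists_eq_forall_mem_Icc_hasDerivWithinAt₀
  have key : ∀ t ∈ Icc (0:ℝ) 1, ∀ w, ‖P t w‖ = ‖w‖ := by
    have hd : ∀ t ∈ Icc (0:ℝ) 1, ∀ w, HasDerivWithinAt (fun t => ⟪P t w, P t w⟫) 0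
        (Icc (0:ℝ) 1) t := by
      intro t ht w
      have h1 := (hP t ht).clm_apply (hasDerivWithinAt_const t (Icc (0:ℝ) 1) w)
      have h2 := h1.inner ℝ h1
      refine h2.congr_deriv ?_
      have h3 := hA t ht (P t w) (P t w)
      have h4 := real_inner_comm (A t (P t w)) (P t w)
      have h5 : ⟪A t (P t w), P t w⟫ = 0 := by linarith
      have h6 : ⟪P t w, A t (P t w)⟫ = 0 := by rw [← h5, real_inner_comm]
      simp [trunc, inner_neg_left, inner_neg_right, inner_smul_left, inner_smul_right, h5, h6]
    intro t ht w
    have hc := constant_of_has_deriv_right_zero (f := fun t => ⟪P t w, P t w⟫) (a := 0) (b := 1)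
      (fun t ht => (hd t ht w).continuousWithinAt)
      (fun t ht => (hd t (Ico_subset_Icc_self ht) w).mono_of_mem_nhdsWithin
        (Icc_mem_nhdsGE_of_mem ht))
    have h1 := hc 1 (by simp)
    have h2 := hc t ht
    have hP1' : P 1 = 1 := hP1
    rw [← h1, hP1'] at h2
    simp only [real_inner_self_eq_norm_sq, one_apply_eq_self] at h2
    exact (sq_eq_sq₀ (norm_nonneg _) (norm_nonneg _)).mp h2
  refine ⟨P, hP1, fun t ht => ?_⟩
  have hn : ‖P t‖ ≤ 1 := ContinuousLinearMap.opNorm_le_bound _ zero_le_one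
    (fun w => by rw [key t ht, one_mul])
  have : trunc (P t) = P t := by simp [trunc, hn]
  have h := hP t ht
  rwa [this] at h

end ODE

section ODEParam

set_option linter.unusedSectionVars false
set_option maxSynthPendingDepth 3

variable {F : Type*} [NormedAddCommGroup F] [InnerProductSpace ℝ F] [FiniteDimensional ℝ F]
  [CompleteSpace F]
variable {H : Type*} [NormedAddCommGroup H] [NormedSpace ℝ H]

/-- `b ↦ a * b * c` as a continuous linear map. -/
noncomputable def conjL (a c : F →L[ℝ] F) : (F →L[ℝ] F) →L[ℝ] (F →L[ℝ] F) :=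
  ((ContinuousLinearMap.mul ℝ (F →L[ℝ] F)).flip c).comp (ContinuousLinearMap.mul ℝ (F →L[ℝ] F) a)

lemma conjL_apply (a b c : F →L[ℝ] F) : conjL a c b = a * b * c := rfl

lemma norm_conjL_le {a c : F →L[ℝ] F} (ha : ‖a‖ ≤ 1) (hc : ‖c‖ ≤ 1) : ‖conjL a c‖ ≤ 1 := by
  apply ContinuousLinearMap.opNorm_le_bound _ zero_le_one
  intro b
  rw [conjL_apply, one_mul]
  exact norm_mul_mul_le ha hc le_rfl

lemma continuousOn_conjL {X : Type*} [TopologicalSpace X] {a c : X → F →L[ℝ] F} {s : Set X}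
    (ha : ContinuousOn a s) (hc : ContinuousOn c s) :
    ContinuousOn (fun x => conjL (a x) (c x)) s := by
  unfold conjL
  exact ((ContinuousLinearMap.continuous _).comp_continuousOn hc).clm_comp
    ((ContinuousLinearMap.continuous _).comp_continuousOn ha)

/-- The derivative of `z ↦ P z 0`. -/
noncomputable def LS (P : ℝ → F →L[ℝ] F) (A' : ℝ → H →L[ℝ] F →L[ℝ] F) : H →L[ℝ] F →L[ℝ] F :=
  (ContinuousLinearMap.mul ℝ (F →L[ℝ] F) (P 0)).comp
    (∫ σ in (0:ℝ)..1, (conjL (adj (P σ)) (P σ)).comp (A' σ))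

structure Fam (O : Set H) (A : H → ℝ → F →L[ℝ] F) (A' : H → ℝ → H →L[ℝ] F →L[ℝ] F)
    (P : H → ℝ → F →L[ℝ] F) (M : ℝ) : Prop where
  op : IsOpen O
  cv : Convex ℝ O
  skew : ∀ z ∈ O, Skew (A z)
  sol : ∀ z ∈ O, Sol (A z) (P z)
  cA : ∀ z ∈ O, ContinuousOn (A z) (Icc 0 1)
  cA' : ∀ z ∈ O, ContinuousOn (A' z) (Icc 0 1)
  cA'z : ∀ σ ∈ Icc (0:ℝ) 1, ContinuousOn (fun z => A' z σ) O
  bd : ∀ z ∈ O, ∀ σ ∈ Icc (0:ℝ) 1, ‖A' z σ‖ ≤ M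
  der : ∀ z ∈ O, ∀ σ ∈ Icc (0:ℝ) 1, HasFDerivAt (fun z => A z σ) (A' z σ) z

variable {O : Set H} {A : H → ℝ → F →L[ℝ] F} {A' : H → ℝ → H →L[ℝ] F →L[ℝ] F}
    {P : H → ℝ → F →L[ℝ] F} {M : ℝ}

lemma Fam.lipA (h : Fam O A A' P M) {z w : H} (hz : z ∈ O) (hw : w ∈ O) {σ : ℝ}
    (hσ : σ ∈ Icc (0:ℝ) 1) : ‖A w σ - A z σ‖ ≤ M * ‖w - z‖ :=
  h.cv.norm_image_sub_le_of_norm_hasFDerivWithin_le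
    (fun x hx => (h.der x hx σ hσ).hasFDerivWithinAt) (fun x hx => h.bd x hx σ hσ) hz hw

lemma Fam.lipP (h : Fam O A A' P M) {z w : H} (hz : z ∈ O) (hw : w ∈ O) {σ : ℝ}
    (hσ : σ ∈ Icc (0:ℝ) 1) : ‖P w σ - P z σ‖ ≤ M * ‖w - z‖ :=
  (h.sol z hz).lip (h.sol w hw) (h.skew z hz) (h.skew w hw) (h.cA z hz) (h.cA w hw)
    (fun _ hτ => h.lipA hz hw hτ) hσ

lemma Fam.nonneg (h : Fam O A A' P M) {z : H} (hz : z ∈ O) : 0 ≤ M :=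
  (norm_nonneg (A' z 0)).trans (h.bd z hz 0 (by simp))

lemma Fam.contP (h : Fam O A A' P M) {σ : ℝ} (hσ : σ ∈ Icc (0:ℝ) 1) :
    ContinuousOn (fun z => P z σ) O := by
  rcases O.eq_empty_or_nonempty with rfl | ⟨z, hz⟩
  · simp
  · have : LipschitzOnWith ⟨M, h.nonneg hz⟩ (fun z => P z σ) O :=
      LipschitzOnWith.of_dist_le_mul (fun x hx y hy => by
        rw [dist_eq_norm, dist_eq_norm]; exact h.lipP hy hx hσ)
    exact this.continuousOn

lemma Fam.hasFDerivAt (h : Fam O A A' P M) {z : H} (hz : z ∈ O) :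
    HasFDerivAt (fun z => P z 0) (LS (P z) (A' z)) z := by
  have hM := h.nonneg hz
  have hO : O ∈ nhds z := h.op.mem_nhds hz
  have hsz := h.sol z hz
  have hkz := h.skew z hz
  -- the parametrized integral
  have key := hasFDerivAt_integral_of_dominated_loc_of_lip' (𝕜 := ℝ)
    (μ := volume.restrict (Ioc (0:ℝ) 1)) (s := O) (x₀ := z)
    (F := fun w σ => adj (P z σ) * (A w σ - A z σ) * P w σ)
    (F' := fun σ => (conjL (adj (P z σ)) (P z σ)).comp (A' z σ)) (bound := fun _ => M) hO
    ?_ ?_ ?_ ?_ ?_ ?_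
  · have h2 := key.2
    have h3 : HasFDerivAt (fun w => P z 0 + P z 0 *
        ∫ σ in Ioc (0:ℝ) 1, adj (P z σ) * (A w σ - A z σ) * P w σ) (LS (P z) (A' z)) z := by
      unfold LS
      rw [intervalIntegral.integral_of_le zero_le_one]
      exact (((ContinuousLinearMap.mul ℝ (F →L[ℝ] F) (P z 0)).hasFDerivAt).comp z h2).const_add _
    refine h3.congr_of_eventuallyEq ?_
    filter_upwards [hO] with w hw
    have := hsz.diff (h.sol w hw) hkz (h.cA z hz) (h.cA w hw) (t := 0) (by simp)
    rw [intervalIntegral.integral_of_le zero_le_one] at this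
    rw [← this]
    abel
  · intro w hw
    refine ContinuousOn.aestronglyMeasurable ?_ measurableSet_Ioc
    exact (((continuousOn_adj hsz.continuousOn).mul ((h.cA w hw).sub (h.cA z hz))).mul
      (h.sol w hw).continuousOn).mono Ioc_subset_Icc_self
  · simp
  · refine ContinuousOn.aestronglyMeasurable ?_ measurableSet_Ioc
    exact ((continuousOn_conjL (continuousOn_adj hsz.continuousOn) hsz.continuousOn).clm_comp
      (h.cA' z hz)).mono Ioc_subset_Icc_self
  · filter_upwards [ae_restrict_mem measurableSet_Ioc] with σ hσ w hw
    have hσ' := Ioc_subset_Icc_self hσ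
    simp only [sub_self, mul_zero, zero_mul, sub_zero]
    exact norm_mul_mul_le (by rw [norm_adj]; exact hsz.norm_le hkz hσ')
      ((h.sol w hw).norm_le (h.skew w hw) hσ') (h.lipA hz hw hσ')
  · exact integrable_const _
  · filter_upwards [ae_restrict_mem measurableSet_Ioc] with σ hσ
    have hσ' := Ioc_subset_Icc_self hσ
    have e : (fun w => adj (P z σ) * (A w σ - A z σ) * P w σ) =
        fun w => conjL (adj (P z σ)) (P z σ) (A w σ - A z σ)
          + adj (P z σ) * (A w σ - A z σ) * (P w σ - P z σ) := by
      funext w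
      rw [conjL_apply]
      noncomm_ring
    have h1 : HasFDerivAt (fun w => conjL (adj (P z σ)) (P z σ) (A w σ - A z σ))
        ((conjL (adj (P z σ)) (P z σ)).comp (A' z σ)) z :=
      (conjL (adj (P z σ)) (P z σ)).hasFDerivAt.comp z ((h.der z hz σ hσ').sub_const _)
    have h2 : HasFDerivAt (fun w => adj (P z σ) * (A w σ - A z σ) * (P w σ - P z σ))
        (0 : H →L[ℝ] F →L[ℝ] F) z := by
      refine Asymptotics.IsBigO.hasFDerivAt (n := 2) ?_ (by norm_num)
      refine Asymptotics.IsBigO.of_bound (M * M) ?_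
      filter_upwards [hO] with w hw
      have a1 : ‖adj (P z σ)‖ ≤ 1 := by rw [norm_adj]; exact hsz.norm_le hkz hσ'
      have a2 := h.lipA hz hw hσ'
      have a3 := h.lipP hz hw hσ'
      calc ‖adj (P z σ) * (A w σ - A z σ) * (P w σ - P z σ)‖
          ≤ ‖adj (P z σ)‖ * ‖A w σ - A z σ‖ * ‖P w σ - P z σ‖ :=
            (norm_mul_le _ _).trans (by gcongr; exact norm_mul_le _ _)
        _ ≤ 1 * (M * ‖w - z‖) * (M * ‖w - z‖) := by gcongr
        _ = M * M * ‖‖w - z‖ ^ 2‖ := by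
            rw [Real.norm_of_nonneg (by positivity)]; ring
    rw [e]
    have h3 := h1.add h2
    rw [add_zero] at h3
    exact h3

lemma Fam.contL (h : Fam O A A' P M) : ContinuousOn (fun z => LS (P z) (A' z)) O := by
  unfold LS
  refine ((ContinuousLinearMap.continuous _).comp_continuousOn
    (h.contP (by simp))).clm_comp ?_
  intro z hz
  refine intervalIntegral.continuousWithinAt_of_dominated_interval (bound := fun _ => M) ?_ ?_ ?_ ?_
  · filter_upwards [self_mem_nhdsWithin] with w hw
    rw [uIoc_of_le zero_le_one]
    refine ContinuousOn.aestronglyMeasurable ?_ measurableSet_Ioc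
    exact ((continuousOn_conjL (continuousOn_adj (h.sol w hw).continuousOn)
      (h.sol w hw).continuousOn).clm_comp (h.cA' w hw)).mono Ioc_subset_Icc_self
  · filter_upwards [self_mem_nhdsWithin] with w hw
    refine Filter.Eventually.of_forall fun σ hσ => ?_
    rw [uIoc_of_le zero_le_one] at hσ
    have hσ' := Ioc_subset_Icc_self hσ
    have hn := (h.sol w hw).norm_le (h.skew w hw) hσ'
    have hM := h.nonneg hz
    calc _ ≤ ‖conjL (adj (P w σ)) (P w σ)‖ * ‖A' w σ‖ := ContinuousLinearMap.opNorm_comp_le _ _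
      _ ≤ 1 * M := by
        gcongr
        · exact norm_conjL_le (by rwa [norm_adj]) hn
        · exact h.bd w hw σ hσ'
      _ = M := one_mul M
  · exact intervalIntegrable_const
  · refine Filter.Eventually.of_forall fun σ hσ => ?_
    rw [uIoc_of_le zero_le_one] at hσ
    have hσ' := Ioc_subset_Icc_self hσ
    exact (continuousOn_conjL (continuousOn_adj (h.contP hσ')) (h.contP hσ')).clm_comp
      (h.cA'z σ hσ') z hz

end ODEParam

section Conn

set_option linter.unusedSectionVars false
set_option maxSynthPendingDepth 3

variable {F : Type*} [NormedAddCommGroup F] [InnerProductSpace ℝ F] [FiniteDimensional ℝ F]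
  [CompleteSpace F]
variable {H : Type*} [NormedAddCommGroup H] [NormedSpace ℝ H]
variable {E : Type*} [NormedAddCommGroup E] [NormedSpace ℝ E]

/-- The segment from `a z` to `b z` at time `σ`, linear in `z`. -/
noncomputable def seg (a b : H →L[ℝ] E) (σ : ℝ) : H →L[ℝ] E := (1 - σ) • a + σ • b

lemma seg_apply (a b : H →L[ℝ] E) (σ : ℝ) (z : H) :
    seg a b σ z = (1 - σ) • a z + σ • b z := rfl

/-- Coefficient of the transport equation along the segment. -/
noncomputable def coefA (Γ : E → E →L[ℝ] F →L[ℝ] F) (a b : H →L[ℝ] E) (z : H) (σ : ℝ) :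
    F →L[ℝ] F := Γ (seg a b σ z) (b z - a z)

/-- Derivative of the coefficient with respect to the parameter. -/
noncomputable def coefA' (Γ : E → E →L[ℝ] F →L[ℝ] F) (DΓ : E → E →L[ℝ] E →L[ℝ] F →L[ℝ] F)
    (a b : H →L[ℝ] E) (z : H) (σ : ℝ) : H →L[ℝ] F →L[ℝ] F :=
  (Γ (seg a b σ z)).comp (b - a) + ((DΓ (seg a b σ z)).flip (b z - a z)).comp (seg a b σ)

lemma coefA'_apply (Γ : E → E →L[ℝ] F →L[ℝ] F) (DΓ : E → E →L[ℝ] E →L[ℝ] F →L[ℝ] F)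
    (a b : H →L[ℝ] E) (z : H) (σ : ℝ) (v : H) :
    coefA' Γ DΓ a b z σ v = Γ (seg a b σ z) (b v - a v)
      + DΓ (seg a b σ z) (seg a b σ v) (b z - a z) := rfl

/-- Hypotheses on the connection. -/
structure Conn (S : Set E) (Γ : E → E →L[ℝ] F →L[ℝ] F)
    (DΓ : E → E →L[ℝ] E →L[ℝ] F →L[ℝ] F) : Prop where
  cpt : IsCompact S
  cv : Convex ℝ S
  der : ∀ z ∈ S, HasFDerivWithinAt Γ (DΓ z) S z
  c0 : ContinuousOn Γ S
  c1 : ContinuousOn DΓ S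
  skew : ∀ z ∈ S, ∀ (v : E) (u w : F), ⟪(Γ z v) u, w⟫ = -⟪u, (Γ z v) w⟫

variable {S : Set E} {Γ : E → E →L[ℝ] F →L[ℝ] F} {DΓ : E → E →L[ℝ] E →L[ℝ] F →L[ℝ] F}
  {a b : H →L[ℝ] E}

lemma seg_mem (hS : Convex ℝ S) {z : H} (ha : a z ∈ S) (hb : b z ∈ S) {σ : ℝ}
    (hσ : σ ∈ Icc (0:ℝ) 1) : seg a b σ z ∈ S :=
  hS ha hb (by linarith [hσ.2]) hσ.1 (by ring)

lemma continuous_seg_left (a b : H →L[ℝ] E) (z : H) : Continuous (fun σ => seg a b σ z) := by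
  simp only [seg_apply]; fun_prop

lemma continuous_seg (a b : H →L[ℝ] E) : Continuous (fun σ => seg a b σ) := by
  unfold seg; fun_prop

lemma Conn.skewA (h : Conn S Γ DΓ) {z : H} (ha : a z ∈ S) (hb : b z ∈ S) :
    Skew (coefA Γ a b z) :=
  fun _ ht u w => h.skew _ (seg_mem h.cv ha hb ht) _ u w

lemma Conn.contA (h : Conn S Γ DΓ) {z : H} (ha : a z ∈ S) (hb : b z ∈ S) :
    ContinuousOn (coefA Γ a b z) (Icc 0 1) := by
  unfold coefA
  exact (h.c0.comp (continuous_seg_left a b z).continuousOn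
    (fun σ hσ => seg_mem h.cv ha hb hσ)).clm_apply continuousOn_const

lemma Conn.contA' (h : Conn S Γ DΓ) {z : H} (ha : a z ∈ S) (hb : b z ∈ S) :
    ContinuousOn (coefA' Γ DΓ a b z) (Icc 0 1) := by
  unfold coefA'
  have hm : MapsTo (fun σ => seg a b σ z) (Icc 0 1) S := fun σ hσ => seg_mem h.cv ha hb hσ
  have h0 := h.c0.comp (continuous_seg_left a b z).continuousOn hm
  have h1 := h.c1.comp (continuous_seg_left a b z).continuousOn hm
  refine (h0.clm_comp continuousOn_const).add
    (ContinuousOn.clm_comp ?_ (continuous_seg a b).continuousOn)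
  exact (((ContinuousLinearMap.flipₗᵢ ℝ E E (F →L[ℝ] F)).continuous.comp_continuousOn
    h1).clm_apply continuousOn_const)

lemma Conn.contA'z (h : Conn S Γ DΓ) {O : Set H} (ha : ∀ z ∈ O, a z ∈ S) (hb : ∀ z ∈ O, b z ∈ S)
    {σ : ℝ} (hσ : σ ∈ Icc (0:ℝ) 1) : ContinuousOn (fun z => coefA' Γ DΓ a b z σ) O := by
  unfold coefA'
  have hm : MapsTo (fun z => seg a b σ z) O S := fun z hz => seg_mem h.cv (ha z hz) (hb z hz) hσ
  have h0 := h.c0.comp (seg a b σ).continuous.continuousOn hm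
  have h1 := h.c1.comp (seg a b σ).continuous.continuousOn hm
  refine (h0.clm_comp continuousOn_const).add
    (ContinuousOn.clm_comp ?_ continuousOn_const)
  exact (((ContinuousLinearMap.flipₗᵢ ℝ E E (F →L[ℝ] F)).continuous.comp_continuousOn
    h1).clm_apply (by fun_prop))

lemma Conn.derA (h : Conn S Γ DΓ) {O : Set H} (hO : IsOpen O)
    (ha : ∀ z ∈ O, a z ∈ S) (hb : ∀ z ∈ O, b z ∈ S)
    {z : H} (hz : z ∈ O) {σ : ℝ} (hσ : σ ∈ Icc (0:ℝ) 1) :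
    HasFDerivAt (fun z => coefA Γ a b z σ) (coefA' Γ DΓ a b z σ) z := by
  unfold coefA
  have h1 : HasFDerivAt (fun z => Γ (seg a b σ z)) ((DΓ (seg a b σ z)).comp (seg a b σ)) z := by
    refine HasFDerivWithinAt.comp_hasFDerivAt (g := Γ) (g' := DΓ (seg a b σ z)) (t := S) z
      (h.der _ (seg_mem h.cv (ha z hz) (hb z hz) hσ)) (seg a b σ).hasFDerivAt ?_
    filter_upwards [hO.mem_nhds hz] with w hw
    exact seg_mem h.cv (ha w hw) (hb w hw) hσ
  have h2 := h1.clm_apply ((b - a).hasFDerivAt (x := z))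
  exact h2

lemma Conn.fam (h : Conn S Γ DΓ) {O : Set H} (hO : IsOpen O) (hcv : Convex ℝ O)
    {ρ : ℝ} (hρ : ∀ z ∈ O, ‖z‖ ≤ ρ)
    (ha : ∀ z ∈ O, a z ∈ S) (hb : ∀ z ∈ O, b z ∈ S)
    {P : H → ℝ → F →L[ℝ] F} (hP : ∀ z ∈ O, Sol (coefA Γ a b z) (P z)) :
    ∃ M, Fam O (coefA Γ a b) (coefA' Γ DΓ a b) P M := by
  obtain ⟨M0, hM0⟩ := h.cpt.exists_bound_of_continuousOn (f := Γ) h.c0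
  obtain ⟨M1, hM1⟩ := h.cpt.exists_bound_of_continuousOn (f := DΓ) h.c1
  refine ⟨M0 * ‖b - a‖ + M1 * (‖b - a‖ * ρ) * (‖a‖ + ‖b‖), ⟨hO, hcv,
    fun z hz => h.skewA (ha z hz) (hb z hz), hP, fun z hz => h.contA (ha z hz) (hb z hz),
    fun z hz => h.contA' (ha z hz) (hb z hz), fun σ hσ => h.contA'z ha hb hσ, ?_,
    fun z hz σ hσ => h.derA hO ha hb hz hσ⟩⟩
  intro z hz σ hσ
  have hs := seg_mem h.cv (ha z hz) (hb z hz) hσ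
  unfold coefA'
  have e1 : ‖seg a b σ‖ ≤ ‖a‖ + ‖b‖ := by
    unfold seg
    refine (norm_add_le _ _).trans ?_
    rw [norm_smul, norm_smul, Real.norm_of_nonneg (by linarith [hσ.2]), Real.norm_of_nonneg hσ.1]
    have := norm_nonneg a
    have := norm_nonneg b
    nlinarith [hσ.1, hσ.2]
  have e2 : ‖b z - a z‖ ≤ ‖b - a‖ * ρ :=
    ((b - a).le_opNorm z).trans (by gcongr; exact hρ z hz)
  have e3 : ‖(DΓ (seg a b σ z)).flip (b z - a z)‖ ≤ M1 * (‖b - a‖ * ρ) := by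
    refine (ContinuousLinearMap.le_opNorm _ _).trans ?_
    rw [ContinuousLinearMap.opNorm_flip]
    have := hM1 _ hs
    have h0 := (norm_nonneg _).trans this
    gcongr
  refine (norm_add_le _ _).trans (add_le_add ?_ ?_)
  · refine (ContinuousLinearMap.opNorm_comp_le _ _).trans ?_
    gcongr
    exact hM0 _ hs
  · refine (ContinuousLinearMap.opNorm_comp_le _ _).trans ?_
    have h0 := (norm_nonneg _).trans e3
    gcongr

/-- Curvature. -/
noncomputable def curv (Γ : E → E →L[ℝ] F →L[ℝ] F) (DΓ : E → E →L[ℝ] E →L[ℝ] F →L[ℝ] F)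
    (z v w : E) : F →L[ℝ] F :=
  DΓ z v w - DΓ z w v + Γ z v * Γ z w - Γ z w * Γ z v

lemma Conn.covariant (h : Conn S Γ DΓ) {z : H} (ha : a z ∈ S) (hb : b z ∈ S)
    {P : ℝ → F →L[ℝ] F} (hP : Sol (coefA Γ a b z) P) {v : H} {κ c : ℝ} (hκ : 0 ≤ κ)
    (hK : ∀ σ ∈ Icc (0:ℝ) 1, ∀ v w, ‖curv Γ DΓ (seg a b σ z) v w‖ ≤ κ * ‖v‖ * ‖w‖)
    (hca : ‖a v‖ ≤ c) (hcb : ‖b v‖ ≤ c) :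
    ‖LS P (coefA' Γ DΓ a b z) v + Γ (a z) (a v) * P 0 - P 0 * Γ (b z) (b v)‖
      ≤ κ * c * ‖b z - a z‖ := by
  have hk := h.skewA ha hb
  have h01 : (0:ℝ) ≤ 1 := zero_le_one
  set w := b z - a z with hw
  set G : ℝ → F →L[ℝ] F := fun σ => Γ (seg a b σ z) (seg a b σ v) with hG
  have hm : MapsTo (fun σ => seg a b σ z) (Icc 0 1) S := fun σ hσ => seg_mem h.cv ha hb hσ
  have hsegd : ∀ (x : H) (σ : ℝ), HasDerivAt (fun σ => seg a b σ x) (b x - a x) σ := by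
    intro x σ
    simp only [seg_apply]
    have h1 := (((hasDerivAt_id σ).const_sub 1).smul_const (a x)).add
      ((hasDerivAt_id σ).smul_const (b x))
    refine h1.congr_deriv ?_
    module
  have hGd : ∀ σ ∈ Icc (0:ℝ) 1, HasDerivWithinAt G
      (DΓ (seg a b σ z) w (seg a b σ v) + Γ (seg a b σ z) (b v - a v)) (Icc 0 1) σ := by
    intro σ hσ
    have h1 : HasDerivWithinAt (fun σ => Γ (seg a b σ z)) (DΓ (seg a b σ z) w) (Icc 0 1) σ :=
      HasFDerivWithinAt.comp_hasDerivWithinAt (l := Γ) (l' := DΓ (seg a b σ z)) (t := S) σ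
        (h.der _ (hm hσ)) (hsegd z σ).hasDerivWithinAt hm
    exact h1.clm_apply (hsegd v σ).hasDerivWithinAt
  have hQGP : ∀ σ ∈ Icc (0:ℝ) 1, HasDerivWithinAt (fun σ => adj (P σ) * G σ * P σ)
      (adj (P σ) * (coefA' Γ DΓ a b z σ v - curv Γ DΓ (seg a b σ z) (seg a b σ v) w) * P σ)
      (Icc 0 1) σ := by
    intro σ hσ
    have h1 := ((hasDeriv_adj (hP.2 σ hσ)).mul (hGd σ hσ)).mul (hP.2 σ hσ)
    refine h1.congr_deriv ?_
    rw [adj_neg, adj_mul, adj_of_skew hk hσ, coefA'_apply]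
    have e : coefA Γ a b z σ = Γ (seg a b σ z) w := rfl
    rw [e]
    simp only [Pi.mul_apply]
    unfold curv
    simp only [hG, hw]
    noncomm_ring
  have hcP := hP.continuousOn
  have hcA' := (h.contA' (DΓ := DΓ) ha hb)
  have hcA'v : ContinuousOn (fun σ => coefA' Γ DΓ a b z σ v) (Icc 0 1) :=
    hcA'.clm_apply continuousOn_const
  have h0 := h.c0.comp (continuous_seg_left a b z).continuousOn hm
  have h1 := h.c1.comp (continuous_seg_left a b z).continuousOn hm
  have hsv := (continuous_seg_left a b v).continuousOn (s := Icc (0:ℝ) 1)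
  have hcK : ContinuousOn (fun σ => curv Γ DΓ (seg a b σ z) (seg a b σ v) w) (Icc 0 1) := by
    unfold curv
    exact ((((h1.clm_apply hsv).clm_apply continuousOn_const).sub
      ((h1.clm_apply continuousOn_const).clm_apply hsv)).add
      ((h0.clm_apply hsv).mul (h0.clm_apply continuousOn_const))).sub
      ((h0.clm_apply continuousOn_const).mul (h0.clm_apply hsv))
  have hcQ := continuousOn_adj hcP
  have hi1 : IntervalIntegrable (fun σ => adj (P σ) * coefA' Γ DΓ a b z σ v * P σ) volume 0 1 :=
    ContinuousOn.intervalIntegrable_of_Icc h01 ((hcQ.mul hcA'v).mul hcP)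
  have hi2 : IntervalIntegrable (fun σ => adj (P σ) * curv Γ DΓ (seg a b σ z) (seg a b σ v) w * P σ)
      volume 0 1 :=
    ContinuousOn.intervalIntegrable_of_Icc h01 ((hcQ.mul hcK).mul hcP)
  have hftc := intervalIntegral.integral_eq_sub_of_hasDerivAt_of_le (a := 0) (b := 1) h01
    (f := fun σ => adj (P σ) * G σ * P σ) (fun σ hσ => (hQGP σ hσ).continuousWithinAt)
    (fun x hx => (hQGP x (Ioo_subset_Icc_self hx)).hasDerivAt (Icc_mem_nhds hx.1 hx.2))
    (by
      have := hi1.sub hi2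
      refine this.congr ?_
      intro σ _
      simp only
      noncomm_ring)
  have hsplit : (∫ σ in (0:ℝ)..1, adj (P σ) *
      (coefA' Γ DΓ a b z σ v - curv Γ DΓ (seg a b σ z) (seg a b σ v) w) * P σ)
      = (∫ σ in (0:ℝ)..1, adj (P σ) * coefA' Γ DΓ a b z σ v * P σ)
        - ∫ σ in (0:ℝ)..1, adj (P σ) * curv Γ DΓ (seg a b σ z) (seg a b σ v) w * P σ := by
    rw [← intervalIntegral.integral_sub hi1 hi2]
    congr 1
    funext σ
    noncomm_ring
  rw [hsplit] at hftc
  have hLS : LS P (coefA' Γ DΓ a b z) v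
      = P 0 * ∫ σ in (0:ℝ)..1, adj (P σ) * coefA' Γ DΓ a b z σ v * P σ := by
    unfold LS
    rw [ContinuousLinearMap.comp_apply, ContinuousLinearMap.intervalIntegral_apply]
    · rfl
    · exact ContinuousOn.intervalIntegrable_of_Icc h01
        ((continuousOn_conjL hcQ hcP).clm_comp hcA')
  have hG1 : G 1 = Γ (b z) (b v) := by simp [hG, seg_apply]
  have hG0 : G 0 = Γ (a z) (a v) := by simp [hG, seg_apply]
  have hPQ := hP.self_mul_adj hk (t := 0) (by simp)
  have hfinal : LS P (coefA' Γ DΓ a b z) v + Γ (a z) (a v) * P 0 - P 0 * Γ (b z) (b v)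
      = P 0 * ∫ σ in (0:ℝ)..1, adj (P σ) * curv Γ DΓ (seg a b σ z) (seg a b σ v) w * P σ := by
    rw [hLS, eq_add_of_sub_eq hftc, hP.1, adj_one, hG1, hG0, one_mul, mul_one]
    have : P 0 * (Γ (b z) (b v) - adj (P 0) * Γ (a z) (a v) * P 0
        + ∫ σ in (0:ℝ)..1, adj (P σ) * curv Γ DΓ (seg a b σ z) (seg a b σ v) w * P σ)
        = P 0 * Γ (b z) (b v) - (P 0 * adj (P 0)) * Γ (a z) (a v) * P 0
        + P 0 * ∫ σ in (0:ℝ)..1, adj (P σ) * curv Γ DΓ (seg a b σ z) (seg a b σ v) w * P σ := by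
      noncomm_ring
    rw [this, hPQ, one_mul]
    abel
  rw [hfinal]
  have hint : ‖∫ σ in (0:ℝ)..1, adj (P σ) * curv Γ DΓ (seg a b σ z) (seg a b σ v) w * P σ‖
      ≤ κ * c * ‖w‖ * |1 - 0| := by
    apply intervalIntegral.norm_integral_le_of_norm_le_const
    intro σ hσ
    rw [uIoc_of_le h01] at hσ
    have hσ' := Ioc_subset_Icc_self hσ
    have hn := hP.norm_le hk hσ'
    refine norm_mul_mul_le (by rwa [norm_adj]) hn ((hK σ hσ' _ _).trans ?_)
    have : ‖seg a b σ v‖ ≤ c := by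
      rw [seg_apply]
      refine (norm_add_le _ _).trans ?_
      rw [norm_smul, norm_smul, Real.norm_of_nonneg (by linarith [hσ'.2]),
        Real.norm_of_nonneg hσ'.1]
      nlinarith [hσ'.1, hσ'.2]
    gcongr
  calc _ ≤ ‖P 0‖ * ‖∫ σ in (0:ℝ)..1,
        adj (P σ) * curv Γ DΓ (seg a b σ z) (seg a b σ v) w * P σ‖ := norm_mul_le _ _
    _ ≤ 1 * (κ * c * ‖w‖ * |1 - 0|) := by
      gcongr
      exact hP.norm_le hk (by simp)
    _ = _ := by simp

/-- Continuity of the transport on arbitrary sets. -/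
lemma Conn.continuousOn_transport (h : Conn S Γ DΓ) {O : Set H}
    {ρ : ℝ} (hρ : ∀ z ∈ O, ‖z‖ ≤ ρ)
    (ha : ∀ z ∈ O, a z ∈ S) (hb : ∀ z ∈ O, b z ∈ S)
    {P : H → ℝ → F →L[ℝ] F} (hP : ∀ z ∈ O, Sol (coefA Γ a b z) (P z)) :
    ContinuousOn (fun z => P z 0) O := by
  -- the coefficients depend uniformly continuously on the parameter
  have huc := h.cpt.uniformContinuousOn_of_continuous (f := Γ) h.c0
  obtain ⟨M0, hM0⟩ := h.cpt.exists_bound_of_continuousOn (f := Γ) h.c0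
  intro z hz
  rw [Metric.continuousWithinAt_iff]
  intro ε hε
  have hM0' : 0 ≤ M0 := (norm_nonneg _).trans (hM0 _ (ha z hz))
  set N := ‖b - a‖ with hN
  have hN0 : 0 ≤ N := norm_nonneg _
  have hρ0 : 0 ≤ ρ := (norm_nonneg _).trans (hρ z hz)
  obtain ⟨δ, hδ, hΓ⟩ := Metric.uniformContinuousOn_iff.mp huc (ε / (4 * (N * ρ + 1)))
    (by positivity)
  refine ⟨min (δ / (2 * (‖a‖ + ‖b‖ + 1))) (ε / (4 * (M0 * N + 1))), by positivity, ?_⟩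
  intro w hw hd
  rw [dist_eq_norm] at hd ⊢
  have hd1 := hd.trans_le (min_le_left _ _)
  have hd2 := hd.trans_le (min_le_right _ _)
  refine lt_of_le_of_lt ((hP z hz).lip (hP w hw) (h.skewA (ha z hz) (hb z hz))
    (h.skewA (ha w hw) (hb w hw)) (h.contA (ha z hz) (hb z hz)) (h.contA (ha w hw) (hb w hw))
    (ε := ε / 2) ?_ (by simp)) (by linarith)
  intro σ hσ
  have e1 : ‖seg a b σ‖ ≤ ‖a‖ + ‖b‖ := by
    unfold seg
    refine (norm_add_le _ _).trans ?_
    rw [norm_smul, norm_smul, Real.norm_of_nonneg (by linarith [hσ.2]), Real.norm_of_nonneg hσ.1]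
    have := norm_nonneg a
    have := norm_nonneg b
    nlinarith [hσ.1, hσ.2]
  have hsz := seg_mem h.cv (ha z hz) (hb z hz) hσ
  have hsw := seg_mem h.cv (ha w hw) (hb w hw) hσ
  have hdist : dist (seg a b σ w) (seg a b σ z) < δ := by
    rw [dist_eq_norm, ← map_sub]
    calc _ ≤ ‖seg a b σ‖ * ‖w - z‖ := (seg a b σ).le_opNorm _
      _ ≤ (‖a‖ + ‖b‖ + 1) * (δ / (2 * (‖a‖ + ‖b‖ + 1))) := by gcongr; linarith
      _ = δ / 2 := by field_simp
      _ < δ := by linarith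
  have h1 := hΓ _ hsw _ hsz hdist
  rw [dist_eq_norm] at h1
  have e : coefA Γ a b w σ - coefA Γ a b z σ
      = (Γ (seg a b σ w) - Γ (seg a b σ z)) ((b - a) w) + Γ (seg a b σ z) ((b - a) (w - z)) := by
    unfold coefA
    simp only [ContinuousLinearMap.sub_apply, map_sub]
    abel
  rw [e]
  have b1 : ‖(b - a) w‖ ≤ N * ρ := ((b - a).le_opNorm w).trans (by gcongr; exact hρ w hw)
  have b2 : ‖(b - a) (w - z)‖ ≤ N * (ε / (4 * (M0 * N + 1))) :=
    ((b - a).le_opNorm _).trans (by gcongr)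
  calc _ ≤ ‖Γ (seg a b σ w) - Γ (seg a b σ z)‖ * ‖(b - a) w‖
        + ‖Γ (seg a b σ z)‖ * ‖(b - a) (w - z)‖ :=
        (norm_add_le _ _).trans (add_le_add (ContinuousLinearMap.le_opNorm _ _)
          (ContinuousLinearMap.le_opNorm _ _))
    _ ≤ ε / (4 * (N * ρ + 1)) * (N * ρ) + M0 * (N * (ε / (4 * (M0 * N + 1)))) := by
        gcongr
        exact hM0 _ hsz
    _ ≤ ε / 4 + ε / 4 := by
        gcongr
        · rw [div_mul_eq_mul_div, div_le_div_iff₀ (by positivity) (by positivity)]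
          nlinarith [mul_nonneg hN0 hρ0]
        · rw [← mul_assoc, mul_div_assoc', div_le_div_iff₀ (by positivity) (by positivity)]
          nlinarith [mul_nonneg hM0' hN0]
    _ = ε / 2 := by ring

end Conn

section Geometry

set_option linter.unusedSectionVars false
set_option maxSynthPendingDepth 3

variable {n : ℕ}

/-- Horizontal projection. -/
noncomputable def px : EuclideanSpace ℝ (Fin (n + 1)) →L[ℝ] EuclideanSpace ℝ (Fin n) :=
  LinearMap.toContinuousLinearMap
    { toFun := fun z => WithLp.toLp 2 (fun i : Fin n => z i.castSucc)
      map_add' := fun x y => by ext i; simp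
      map_smul' := fun c x => by ext i; simp }

/-- Height. -/
noncomputable def pt : EuclideanSpace ℝ (Fin (n + 1)) →L[ℝ] ℝ :=
  LinearMap.toContinuousLinearMap
    { toFun := fun z => z (Fin.last n)
      map_add' := fun x y => by simp
      map_smul' := fun c x => by simp }

lemma emb_castSucc (x : EuclideanSpace ℝ (Fin n)) (t : ℝ) (i : Fin n) :
    emb x t i.castSucc = x i := by
  simp [emb]

lemma emb_last (x : EuclideanSpace ℝ (Fin n)) (t : ℝ) :
    emb x t (Fin.last n) = t := by
  simp [emb]

lemma px_apply (z : EuclideanSpace ℝ (Fin (n + 1))) (i : Fin n) : px z i = z i.castSucc := rfl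

lemma pt_apply (z : EuclideanSpace ℝ (Fin (n + 1))) : pt z = z (Fin.last n) := rfl

lemma px_emb (x : EuclideanSpace ℝ (Fin n)) (t : ℝ) : px (emb x t) = x := by
  ext i; rw [px_apply, emb_castSucc]

lemma pt_emb (x : EuclideanSpace ℝ (Fin n)) (t : ℝ) : pt (emb x t) = t := by
  rw [pt_apply, emb_last]

lemma emb_px_pt (z : EuclideanSpace ℝ (Fin (n + 1))) : emb (px z) (pt z) = z := by
  ext i
  refine Fin.lastCases ?_ (fun i => ?_) i
  · rw [emb_last, pt_apply]
  · rw [emb_castSucc, px_apply]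

/-- Inclusion at height `0`. -/
noncomputable def io : EuclideanSpace ℝ (Fin n) →L[ℝ] EuclideanSpace ℝ (Fin (n + 1)) :=
  LinearMap.toContinuousLinearMap
    { toFun := fun x => emb x 0
      map_add' := fun x y => by
        ext i
        refine Fin.lastCases ?_ (fun i => ?_) i
        · simp [emb_last]
        · simp [emb_castSucc]
      map_smul' := fun c x => by
        ext i
        refine Fin.lastCases ?_ (fun i => ?_) i
        · simp [emb_last]
        · simp [emb_castSucc] }

lemma io_apply (x : EuclideanSpace ℝ (Fin n)) : io x = emb x 0 := rfl

/-- Vertical unit vector. -/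
noncomputable def ev : EuclideanSpace ℝ (Fin (n + 1)) := emb 0 1

lemma emb_eq (x : EuclideanSpace ℝ (Fin n)) (t : ℝ) : emb x t = io x + t • ev := by
  ext i
  refine Fin.lastCases ?_ (fun i => ?_) i
  · simp [emb_last, io_apply, ev]
  · simp [emb_castSucc, io_apply, ev]

lemma norm_sq_eq (z : EuclideanSpace ℝ (Fin (n + 1))) : ‖z‖ ^ 2 = ‖px z‖ ^ 2 + pt z ^ 2 := by
  rw [EuclideanSpace.norm_sq_eq, EuclideanSpace.norm_sq_eq, Fin.sum_univ_castSucc]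
  simp [px_apply, pt_apply]

lemma norm_px_le (z : EuclideanSpace ℝ (Fin (n + 1))) : ‖px z‖ ≤ ‖z‖ := by
  have := norm_sq_eq z
  exact abs_le_of_sq_le_sq' (by nlinarith [sq_nonneg (pt z)]) (norm_nonneg _) |>.2

lemma abs_pt_le (z : EuclideanSpace ℝ (Fin (n + 1))) : |pt z| ≤ ‖z‖ := by
  have := norm_sq_eq z
  exact abs_le_of_sq_le_sq (by nlinarith [sq_nonneg ‖px z‖]) (norm_nonneg _)

lemma norm_io (x : EuclideanSpace ℝ (Fin n)) : ‖io x‖ = ‖x‖ := by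
  have := norm_sq_eq (io x)
  rw [io_apply, px_emb, pt_emb] at this
  rw [io_apply]
  exact (sq_eq_sq₀ (norm_nonneg _) (norm_nonneg _)).mp (by linarith)

lemma norm_ev : ‖(ev : EuclideanSpace ℝ (Fin (n + 1)))‖ = 1 := by
  have := norm_sq_eq (ev : EuclideanSpace ℝ (Fin (n + 1)))
  rw [ev, px_emb, pt_emb] at this
  rw [ev]
  exact (sq_eq_sq₀ (norm_nonneg _) (by norm_num)).mp (by simpa using this)

lemma continuous_emb : Continuous (fun q : EuclideanSpace ℝ (Fin n) × ℝ => emb q.1 q.2) := by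
  simp only [emb_eq]
  fun_prop

lemma mem_closedCylinder {r R : ℝ} {z : EuclideanSpace ℝ (Fin (n + 1))} :
    z ∈ closedCylinder n r R ↔ ‖px z‖ ≤ r ∧ pt z ∈ Icc (0:ℝ) R := by
  constructor
  · rintro ⟨x, hx, t, ht, rfl⟩
    rw [px_emb, pt_emb]
    exact ⟨by simpa using hx, ht⟩
  · rintro ⟨h1, h2⟩
    exact ⟨px z, by simpa using h1, pt z, h2, (emb_px_pt z).symm⟩

lemma mem_openCylinder {r R : ℝ} {z : EuclideanSpace ℝ (Fin (n + 1))} :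
    z ∈ openCylinder n r R ↔ ‖px z‖ < r ∧ pt z ∈ Ioo (0:ℝ) R := by
  constructor
  · rintro ⟨x, hx, t, ht, rfl⟩
    rw [px_emb, pt_emb]
    exact ⟨by simpa using hx, ht⟩
  · rintro ⟨h1, h2⟩
    exact ⟨px z, by simpa using h1, pt z, h2, (emb_px_pt z).symm⟩

lemma isOpen_openCylinder (r R : ℝ) : IsOpen (openCylinder n r R) := by
  have : openCylinder n r R = {z | ‖px z‖ < r} ∩ pt ⁻¹' (Ioo (0:ℝ) R) := by
    ext z; exact mem_openCylinder
  rw [this]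
  exact (isOpen_lt (by fun_prop) continuous_const).inter (isOpen_Ioo.preimage pt.continuous)

lemma convex_openCylinder (r R : ℝ) : Convex ℝ (openCylinder n r R) := by
  have : openCylinder n r R = px ⁻¹' (ball 0 r) ∩ pt ⁻¹' (Ioo (0:ℝ) R) := by
    ext z; rw [mem_openCylinder]; simp
  rw [this]
  exact ((convex_ball 0 r).linear_preimage (px (n := n)).toLinearMap).inter
    ((convex_Ioo 0 R).linear_preimage (pt (n := n)).toLinearMap)

lemma convex_closedCylinder (r R : ℝ) : Convex ℝ (closedCylinder n r R) := by
  have : closedCylinder n r R = px ⁻¹' (closedBall 0 r) ∩ pt ⁻¹' (Icc (0:ℝ) R) := by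
    ext z; rw [mem_closedCylinder]; simp
  rw [this]
  exact ((convex_closedBall 0 r).linear_preimage (px (n := n)).toLinearMap).inter
    ((convex_Icc 0 R).linear_preimage (pt (n := n)).toLinearMap)

lemma isCompact_closedCylinder (r R : ℝ) : IsCompact (closedCylinder n r R) := by
  have : closedCylinder n r R = (fun q : EuclideanSpace ℝ (Fin n) × ℝ => emb q.1 q.2) ''
      (closedBall 0 r ×ˢ Icc (0:ℝ) R) := by
    ext z
    constructor
    · rintro ⟨x, hx, t, ht, rfl⟩
      exact ⟨(x, t), ⟨hx, ht⟩, rfl⟩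
    · rintro ⟨⟨x, t⟩, ⟨hx, ht⟩, rfl⟩
      exact ⟨x, hx, t, ht, rfl⟩
  rw [this]
  exact ((isCompact_closedBall 0 r).prod isCompact_Icc).image continuous_emb

lemma hsNorm_le {m : ℕ} {F : Type*} [NormedAddCommGroup F] [InnerProductSpace ℝ F]
    (T : EuclideanSpace ℝ (Fin m) →L[ℝ] F) {c : ℝ} (hc : 0 ≤ c) (h : ∀ v, ‖T v‖ ≤ c * ‖v‖) :
    hsNorm T ≤ Real.sqrt m * c := by
  unfold hsNorm
  have : ∑ i : Fin m, ‖T (EuclideanSpace.single i (1 : ℝ))‖ ^ 2 ≤ m * c ^ 2 := by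
    calc _ ≤ ∑ i : Fin m, c ^ 2 := by
          gcongr with i
          simpa using h (EuclideanSpace.single i (1 : ℝ))
      _ = _ := by simp
  calc _ ≤ Real.sqrt (m * c ^ 2) := Real.sqrt_le_sqrt this
    _ = _ := by rw [Real.sqrt_mul (by positivity), Real.sqrt_sq hc]

lemma hsNorm_nonneg {m : ℕ} {F : Type*} [NormedAddCommGroup F] [InnerProductSpace ℝ F]
    (T : EuclideanSpace ℝ (Fin m) →L[ℝ] F) : 0 ≤ hsNorm T := Real.sqrt_nonneg _

end Geometry

section Transports

set_option linter.unusedSectionVars false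
set_option maxSynthPendingDepth 3

variable {n : ℕ} {F : Type*} [NormedAddCommGroup F] [InnerProductSpace ℝ F]
  [FiniteDimensional ℝ F] [CompleteSpace F]

/-- Properties of the horizontal transport. -/
structure HT (R κ : ℝ)
    (Γ : EuclideanSpace ℝ (Fin (n + 1)) → EuclideanSpace ℝ (Fin (n + 1)) →L[ℝ] F →L[ℝ] F)
    (Rt : EuclideanSpace ℝ (Fin n) → EuclideanSpace ℝ (Fin n) → F →L[ℝ] F)
    (DR : EuclideanSpace ℝ (Fin n) → EuclideanSpace ℝ (Fin n) →
      EuclideanSpace ℝ (Fin n) →L[ℝ] F →L[ℝ] F) : Prop where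
  c0 : ContinuousOn (fun q : EuclideanSpace ℝ (Fin n) × EuclideanSpace ℝ (Fin n) => Rt q.1 q.2)
    (ball 0 (2 * R) ×ˢ ball 0 (2 * R))
  c1 : ContinuousOn (fun q : EuclideanSpace ℝ (Fin n) × EuclideanSpace ℝ (Fin n) => DR q.1 q.2)
    (ball 0 (2 * R) ×ˢ ball 0 (2 * R))
  der : ∀ x ∈ ball (0 : EuclideanSpace ℝ (Fin n)) (2 * R),
    ∀ y ∈ ball (0 : EuclideanSpace ℝ (Fin n)) (2 * R),
    HasFDerivAt (fun x => Rt x y) (DR x y) x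
  bd : ∀ x ∈ ball (0 : EuclideanSpace ℝ (Fin n)) (2 * R),
    ∀ y ∈ ball (0 : EuclideanSpace ℝ (Fin n)) (2 * R), ∀ v,
    ‖DR x y v + Γ (io x) (io v) * Rt x y‖ ≤ κ * ‖v‖ * ‖x - y‖
  iso : ∀ x ∈ ball (0 : EuclideanSpace ℝ (Fin n)) (2 * R),
    ∀ y ∈ ball (0 : EuclideanSpace ℝ (Fin n)) (2 * R), ∀ w, ‖Rt x y w‖ = ‖w‖
  diag : ∀ x ∈ ball (0 : EuclideanSpace ℝ (Fin n)) (2 * R), Rt x x = 1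

/-- Properties of the vertical transport. -/
structure VT (R κ : ℝ)
    (Γ : EuclideanSpace ℝ (Fin (n + 1)) → EuclideanSpace ℝ (Fin (n + 1)) →L[ℝ] F →L[ℝ] F)
    (g : EuclideanSpace ℝ (Fin (n + 1)) → F →L[ℝ] F)
    (Dg : EuclideanSpace ℝ (Fin (n + 1)) → EuclideanSpace ℝ (Fin (n + 1)) →L[ℝ] F →L[ℝ] F) :
    Prop where
  c0 : ContinuousOn g (closedCylinder n (2 * R) R)
  c1 : ContinuousOn Dg (openCylinder n (2 * R) R)
  der : ∀ z ∈ openCylinder n (2 * R) R, HasFDerivAt g (Dg z) z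
  bd : ∀ z ∈ openCylinder n (2 * R) R, ∀ v,
    ‖Dg z v + Γ z v * g z - g z * Γ (io (px z)) (io (px v))‖ ≤ κ * ‖v‖ * pt z
  iso : ∀ z ∈ closedCylinder n (2 * R) R, ∀ w, ‖g z w‖ = ‖w‖
  diag : ∀ x ∈ ball (0 : EuclideanSpace ℝ (Fin n)) (2 * R), g (io x) = 1

variable {R κ : ℝ}
  {Γ : EuclideanSpace ℝ (Fin (n + 1)) → EuclideanSpace ℝ (Fin (n + 1)) →L[ℝ] F →L[ℝ] F}
  {DΓ : EuclideanSpace ℝ (Fin (n + 1)) →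
          EuclideanSpace ℝ (Fin (n + 1)) →L[ℝ] EuclideanSpace ℝ (Fin (n + 1)) →L[ℝ] F →L[ℝ] F}

lemma sol_const {H E : Type*} [NormedAddCommGroup H] [NormedSpace ℝ H]
    [NormedAddCommGroup E] [NormedSpace ℝ E] {Γ : E → E →L[ℝ] F →L[ℝ] F} {a b : H →L[ℝ] E} {z : H}
    (h : b z = a z) : Sol (coefA Γ a b z) (fun _ => 1) := by
  refine ⟨rfl, fun t _ => ?_⟩
  have : coefA Γ a b z t = 0 := by simp [coefA, h]
  rw [this, zero_mul, neg_zero]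
  exact hasDerivWithinAt_const _ _ _

lemma io_mem (hR : 0 < R) {x : EuclideanSpace ℝ (Fin n)} (hx : x ∈ ball 0 (2 * R)) :
    io x ∈ closedCylinder n (2 * R) R := by
  rw [mem_closedCylinder, io_apply, px_emb, pt_emb]
  simp at hx
  exact ⟨hx.le, le_rfl, hR.le⟩

/-- Extension of the curvature bound to the bottom of the cylinder. -/
lemma curv_bottom (hR : 0 < R) (hC : Conn (closedCylinder n (2 * R) R) Γ DΓ)
    (hK : ∀ z ∈ openCylinder n (2 * R) R, ∀ v w, ‖curv Γ DΓ z v w‖ ≤ κ * ‖v‖ * ‖w‖)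
    {z : EuclideanSpace ℝ (Fin (n + 1))} (hz : ‖px z‖ < 2 * R) (ht : pt z ∈ Ico 0 R)
    (v w : EuclideanSpace ℝ (Fin (n + 1))) : ‖curv Γ DΓ z v w‖ ≤ κ * ‖v‖ * ‖w‖ := by
  have hcl : z ∈ closure (openCylinder n (2 * R) R) := by
    have hc : Filter.Tendsto (fun e : ℝ => z + e • ev) (nhdsWithin 0 (Ioi 0)) (nhds z) := by
      have : Continuous (fun e : ℝ => z + e • (ev : EuclideanSpace ℝ (Fin (n + 1)))) := by fun_prop
      have h := this.tendsto 0
      simp only [zero_smul, add_zero] at h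
      exact h.mono_left nhdsWithin_le_nhds
    refine mem_closure_of_tendsto hc ?_
    have : Ioo (0:ℝ) (R - pt z) ∈ nhdsWithin (0:ℝ) (Ioi 0) :=
      Ioo_mem_nhdsGT (by linarith [ht.2])
    filter_upwards [this] with e he
    rw [mem_openCylinder]
    simp only [map_add, map_smul, ev, px_emb, pt_emb]
    constructor
    · simpa using hz
    · simp only [smul_eq_mul, mul_one, mem_Ioo]
      constructor <;> linarith [he.1, he.2, ht.1]
  have hzS : z ∈ closedCylinder n (2 * R) R := by
    rw [mem_closedCylinder]; exact ⟨hz.le, ht.1, ht.2.le⟩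
  have hsub : openCylinder n (2 * R) R ⊆ closedCylinder n (2 * R) R := fun y hy => by
    rw [mem_closedCylinder]; rw [mem_openCylinder] at hy
    exact ⟨hy.1.le, hy.2.1.le, hy.2.2.le⟩
  have hcont : ContinuousWithinAt (fun z => ‖curv Γ DΓ z v w‖) (openCylinder n (2 * R) R) z := by
    have c0 := (hC.c0 z hzS).mono hsub
    have c1 := (hC.c1 z hzS).mono hsub
    have e0 : ∀ v, ContinuousWithinAt (fun z => Γ z v) (openCylinder n (2 * R) R) z :=
      fun v => c0.clm_apply continuousWithinAt_const
    have e1 : ∀ v w, ContinuousWithinAt (fun z => DΓ z v w) (openCylinder n (2 * R) R) z :=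
      fun v w => (c1.clm_apply continuousWithinAt_const).clm_apply continuousWithinAt_const
    unfold curv
    exact ((((e1 v w).sub (e1 w v)).add ((e0 v).mul (e0 w))).sub ((e0 w).mul (e0 v))).norm
  haveI : (nhdsWithin z (openCylinder n (2 * R) R)).NeBot := mem_closure_iff_nhdsWithin_neBot.mp hcl
  refine le_of_tendsto hcont ?_
  filter_upwards [self_mem_nhdsWithin] with y hy using hK y hy v w

lemma exists_HT (hR : 0 < R) (hκ : 0 ≤ κ) (hC : Conn (closedCylinder n (2 * R) R) Γ DΓ)
    (hK : ∀ z ∈ openCylinder n (2 * R) R, ∀ v w, ‖curv Γ DΓ z v w‖ ≤ κ * ‖v‖ * ‖w‖)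
    {Rt : EuclideanSpace ℝ (Fin n) → EuclideanSpace ℝ (Fin n) → F →L[ℝ] F}
    (hRt : ∀ x ∈ ball (0 : EuclideanSpace ℝ (Fin n)) (2 * R),
         ∀ y ∈ ball (0 : EuclideanSpace ℝ (Fin n)) (2 * R), ∃ P : ℝ → F →L[ℝ] F,
          P 1 = ContinuousLinearMap.id ℝ F ∧
          (∀ t ∈ Icc (0:ℝ) 1, HasDerivWithinAt P
            (-((Γ (emb ((1 - t) • x + t • y) 0)) (emb (y - x) 0)).comp (P t))
            (Icc (0:ℝ) 1) t) ∧
          Rt x y = P 0) : ∃ DR, HT R κ Γ Rt DR := by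
  set a : EuclideanSpace ℝ (Fin n) × EuclideanSpace ℝ (Fin n) →L[ℝ] EuclideanSpace ℝ (Fin (n+1)) :=
    io.comp (ContinuousLinearMap.fst ℝ _ _) with ha
  set b : EuclideanSpace ℝ (Fin n) × EuclideanSpace ℝ (Fin n) →L[ℝ] EuclideanSpace ℝ (Fin (n+1)) :=
    io.comp (ContinuousLinearMap.snd ℝ _ _) with hb
  set O : Set (EuclideanSpace ℝ (Fin n) × EuclideanSpace ℝ (Fin n)) :=
    ball 0 (2 * R) ×ˢ ball 0 (2 * R) with hO
  have hex : ∀ q ∈ O, ∃ P, Sol (coefA Γ a b q) P ∧ Rt q.1 q.2 = P 0 := by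
    rintro ⟨x, y⟩ ⟨hx, hy⟩
    obtain ⟨P, h1, h2, h3⟩ := hRt x hx y hy
    refine ⟨P, ⟨h1, fun t ht => ?_⟩, h3⟩
    refine (h2 t ht).congr_deriv ?_
    have e1 : emb ((1 - t) • x + t • y) 0 = seg a b t (x, y) := by
      rw [seg_apply, ← io_apply, map_add, map_smul, map_smul]; rfl
    have e2 : emb (y - x) 0 = b (x, y) - a (x, y) := by
      rw [← io_apply, map_sub]; rfl
    rw [e1, e2]; rfl
  choose! P hP hPR using hex
  have haS : ∀ z ∈ O, a z ∈ closedCylinder n (2 * R) R := fun z hz => io_mem hR hz.1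
  have hbS : ∀ z ∈ O, b z ∈ closedCylinder n (2 * R) R := fun z hz => io_mem hR hz.2
  have hOo : IsOpen O := isOpen_ball.prod isOpen_ball
  have hOc : Convex ℝ O := (convex_ball _ _).prod (convex_ball _ _)
  obtain ⟨M, hF⟩ := hC.fam hOo hOc (ρ := 2 * R) (fun z hz => by
    have h1 := hz.1; have h2 := hz.2
    simp at h1 h2
    exact max_le h1.le h2.le) haS hbS hP
  refine ⟨fun x y => (LS (P (x, y)) (coefA' Γ DΓ a b (x, y))).comp
    (ContinuousLinearMap.inl ℝ _ _), ?_, ?_, ?_, ?_, ?_, ?_⟩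
  · exact (hF.contP (σ := 0) (by simp)).congr (fun q hq => hPR q hq)
  · exact hF.contL.clm_comp continuousOn_const
  · intro x hx y hy
    have h1 := hF.hasFDerivAt (z := (x, y)) ⟨hx, hy⟩
    have h2 : HasFDerivAt (fun q : EuclideanSpace ℝ (Fin n) × EuclideanSpace ℝ (Fin n) =>
        Rt q.1 q.2) (LS (P (x, y)) (coefA' Γ DΓ a b (x, y))) (x, y) := by
      refine h1.congr_of_eventuallyEq ?_
      filter_upwards [hOo.mem_nhds (show (x, y) ∈ O from ⟨hx, hy⟩)] with q hq using hPR q hq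
    have h3 : HasFDerivAt (fun x' : EuclideanSpace ℝ (Fin n) => (x', y))
        (ContinuousLinearMap.inl ℝ _ _) x := hasFDerivAt_prodMk_left x y
    exact h2.comp x h3
  · intro x hx y hy v
    have hq : (x, y) ∈ O := ⟨hx, hy⟩
    have h1 := hC.covariant (haS _ hq) (hbS _ hq) (hP _ hq) (v := (v, 0)) (c := ‖v‖) hκ
      (by
        intro σ hσ v w
        have : seg a b σ (x, y) = io ((1 - σ) • x + σ • y) := by
          rw [seg_apply, map_add, map_smul, map_smul]; rfl
        have hm := convex_ball (0 : EuclideanSpace ℝ (Fin n)) (2 * R) hx hy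
          (sub_nonneg.mpr hσ.2) hσ.1 (by ring)
        refine curv_bottom hR hC hK ?_ ?_ v w
        · rw [this, io_apply, px_emb]; simpa using hm
        · rw [this, io_apply, pt_emb]; exact ⟨le_rfl, hR⟩)
      (by show ‖io v‖ ≤ _; rw [norm_io]) (by show ‖io 0‖ ≤ _; rw [norm_io]; simp)
    have hb0 : b (v, 0) = 0 := by show io 0 = 0; simp
    have hba : ‖b (x, y) - a (x, y)‖ = ‖x - y‖ := by
      show ‖io y - io x‖ = _
      rw [← map_sub, norm_io, norm_sub_rev]
    rw [hb0, map_zero, mul_zero, sub_zero, hba, ← hPR _ hq] at h1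
    exact h1
  · intro x hx y hy w
    have hq : (x, y) ∈ O := ⟨hx, hy⟩
    rw [hPR _ hq]
    exact (hP _ hq).norm_apply (hC.skewA (haS _ hq) (hbS _ hq)) (by simp) w
  · intro x hx
    have hq : (x, x) ∈ O := ⟨hx, hx⟩
    rw [hPR _ hq]
    exact (sol_const (a := a) (b := b) (z := (x, x)) rfl).unique (hP _ hq)
      (hC.skewA (haS _ hq) (hbS _ hq)) (hC.contA (haS _ hq) (hbS _ hq)) (by simp)

lemma exists_VT (hR : 0 < R) (hκ : 0 ≤ κ) (hC : Conn (closedCylinder n (2 * R) R) Γ DΓ)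
    (hK : ∀ z ∈ openCylinder n (2 * R) R, ∀ v w, ‖curv Γ DΓ z v w‖ ≤ κ * ‖v‖ * ‖w‖) :
    ∃ g Dg, VT R κ Γ g Dg := by
  set a : EuclideanSpace ℝ (Fin (n+1)) →L[ℝ] EuclideanSpace ℝ (Fin (n+1)) :=
    ContinuousLinearMap.id ℝ _ with ha
  set b : EuclideanSpace ℝ (Fin (n+1)) →L[ℝ] EuclideanSpace ℝ (Fin (n+1)) :=
    io.comp px with hb
  set S := closedCylinder n (2 * R) R with hS
  have haS : ∀ z ∈ S, a z ∈ S := fun z hz => hz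
  have hbS : ∀ z ∈ S, b z ∈ S := fun z hz => by
    show io (px z) ∈ _
    rw [hS, mem_closedCylinder] at *
    rw [io_apply, px_emb, pt_emb]
    exact ⟨hz.1, le_rfl, hR.le⟩
  have hsub : openCylinder n (2 * R) R ⊆ S := fun y hy => by
    rw [hS, mem_closedCylinder]; rw [mem_openCylinder] at hy
    exact ⟨hy.1.le, hy.2.1.le, hy.2.2.le⟩
  have hex : ∀ z ∈ S, ∃ P, Sol (coefA Γ a b z) P := fun z hz =>
    exists_Sol (hC.skewA (haS z hz) (hbS z hz)) (hC.contA (haS z hz) (hbS z hz))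
  choose! P hP using hex
  have hbdd : ∃ ρ, ∀ z ∈ S, ‖z‖ ≤ ρ := by
    obtain ⟨ρ, hρ⟩ := (isCompact_closedCylinder (n := n) (2 * R) R).isBounded.exists_norm_le
    exact ⟨ρ, hρ⟩
  obtain ⟨ρ, hρ⟩ := hbdd
  obtain ⟨M, hF⟩ := hC.fam (isOpen_openCylinder (n := n) (2 * R) R)
    (convex_openCylinder (n := n) (2 * R) R) (fun z hz => hρ z (hsub hz))
    (fun z hz => haS z (hsub hz)) (fun z hz => hbS z (hsub hz)) (fun z hz => hP z (hsub hz))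
  refine ⟨fun z => P z 0, fun z => LS (P z) (coefA' Γ DΓ a b z), ?_, ?_, ?_, ?_, ?_, ?_⟩
  · exact hC.continuousOn_transport hρ haS hbS hP
  · exact hF.contL
  · intro z hz; exact hF.hasFDerivAt hz
  · intro z hz v
    have hz' := mem_openCylinder.mp hz
    have h1 := hC.covariant (haS _ (hsub hz)) (hbS _ (hsub hz)) (hP _ (hsub hz)) (v := v)
      (c := ‖v‖) hκ
      (by
        intro σ hσ v w
        have e : seg a b σ z = (1 - σ) • z + σ • io (px z) := rfl
        refine curv_bottom hR hC hK ?_ ?_ v w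
        · rw [e, map_add, map_smul, map_smul, io_apply, px_emb, ← add_smul]
          simpa using hz'.1
        · rw [e, map_add, map_smul, map_smul, io_apply, pt_emb]
          simp only [smul_eq_mul, mul_zero, add_zero, mem_Ico]
          have := hz'.2.1
          have := hz'.2.2
          have := hσ.1
          have := hσ.2
          constructor
          · exact mul_nonneg (by linarith) (by linarith)
          · nlinarith)
      le_rfl (by show ‖io (px v)‖ ≤ _; rw [norm_io]; exact norm_px_le v)
    have hba : ‖b z - a z‖ = pt z := by
      show ‖io (px z) - z‖ = _
      have : io (px z) - z = -(pt z • ev) := by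
        nth_rewrite 2 [← emb_px_pt z]
        rw [emb_eq]; abel
      rw [this, norm_neg, norm_smul, norm_ev, mul_one, Real.norm_of_nonneg hz'.2.1.le]
    rw [hba] at h1
    exact h1
  · intro z hz w
    exact (hP _ hz).norm_apply (hC.skewA (haS _ hz) (hbS _ hz)) (by simp) w
  · intro x hx
    have hq := io_mem (n := n) hR hx
    have e : b (io x) = a (io x) := by
      show io (px (io x)) = io x
      rw [io_apply x, px_emb, io_apply]
    exact (sol_const e).unique (hP _ hq)
      (hC.skewA (haS _ hq) (hbS _ hq)) (hC.contA (haS _ hq) (hbS _ hq)) (by simp)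

end Transports

section Param

set_option linter.unusedSectionVars false
set_option maxSynthPendingDepth 3

variable {E : Type*} [NormedAddCommGroup E] [NormedSpace ℝ E]
  {Y : Type*} [MetricSpace Y] [SecondCountableTopology Y] [MeasurableSpace Y] [BorelSpace Y]
  {F : Type*} [NormedAddCommGroup F] [NormedSpace ℝ F]
  {μ : Measure Y} [IsFiniteMeasureOnCompacts μ]

lemma param_cont {O : Set E} {K : Set Y} (hO : IsCompact O) (hK : IsCompact K) {h : E → Y → F}
    (hc : ContinuousOn (fun q : E × Y => h q.1 q.2) (O ×ˢ K)) :
    ContinuousOn (fun z => ∫ y in K, h z y ∂μ) O := by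
  obtain ⟨M, hM⟩ := (hO.prod hK).exists_bound_of_continuousOn hc
  have hsl : ∀ z ∈ O, ContinuousOn (h z) K := fun z hz =>
    hc.comp (f := fun y => (z, y)) (by fun_prop) (fun y hy => ⟨hz, hy⟩)
  have hsl2 : ∀ y ∈ K, ContinuousOn (fun z => h z y) O := fun y hy =>
    hc.comp (f := fun z => (z, y)) (by fun_prop) (fun z hz => ⟨hz, hy⟩)
  intro z hz
  refine continuousWithinAt_of_dominated (bound := fun _ => M) ?_ ?_ ?_ ?_
  · filter_upwards [self_mem_nhdsWithin] with w hw
    exact (hsl w hw).aestronglyMeasurable hK.measurableSet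
  · filter_upwards [self_mem_nhdsWithin] with w hw
    filter_upwards [ae_restrict_mem hK.measurableSet] with y hy
    exact hM (w, y) ⟨hw, hy⟩
  · exact integrableOn_const hK.measure_lt_top.ne
  · filter_upwards [ae_restrict_mem hK.measurableSet] with y hy
    exact hsl2 y hy z hz

variable [ProperSpace E]

lemma param_cont_open {O : Set E} {K : Set Y} (hO : IsOpen O) (hK : IsCompact K) {h : E → Y → F}
    (hc : ContinuousOn (fun q : E × Y => h q.1 q.2) (O ×ˢ K)) :
    ContinuousOn (fun z => ∫ y in K, h z y ∂μ) O := by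
  intro z hz
  obtain ⟨r, hr, hsub⟩ := Metric.isOpen_iff.mp hO z hz
  have h1 : closedBall z (r / 2) ⊆ O := (closedBall_subset_ball (by linarith)).trans hsub
  have h2 := param_cont (μ := μ) (isCompact_closedBall z (r / 2)) hK
    (hc.mono (prod_mono h1 le_rfl))
  exact (h2.continuousAt (closedBall_mem_nhds z (by linarith))).continuousWithinAt

lemma param_deriv {O : Set E} {K : Set Y} (hO : IsOpen O) (hK : IsCompact K) {h : E → Y → F}
    {h' : E → Y → E →L[ℝ] F}
    (hc : ContinuousOn (fun q : E × Y => h q.1 q.2) (O ×ˢ K))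
    (hc' : ContinuousOn (fun q : E × Y => h' q.1 q.2) (O ×ˢ K))
    (hd : ∀ z ∈ O, ∀ y ∈ K, HasFDerivAt (fun z => h z y) (h' z y) z) {z : E} (hz : z ∈ O) :
    HasFDerivAt (fun z => ∫ y in K, h z y ∂μ) (∫ y in K, h' z y ∂μ) z := by
  obtain ⟨r, hr, hsub⟩ := Metric.isOpen_iff.mp hO z hz
  have h1 : closedBall z (r / 2) ⊆ O := (closedBall_subset_ball (by linarith)).trans hsub
  obtain ⟨M, hM⟩ := ((isCompact_closedBall z (r / 2)).prod hK).exists_bound_of_continuousOn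
    (hc'.mono (prod_mono h1 le_rfl))
  have hsl : ∀ z ∈ O, ContinuousOn (h z) K := fun z hz =>
    hc.comp (f := fun y => (z, y)) (by fun_prop) (fun y hy => ⟨hz, hy⟩)
  have hsl' : ∀ z ∈ O, ContinuousOn (h' z) K := fun z hz =>
    hc'.comp (f := fun y => (z, y)) (by fun_prop) (fun y hy => ⟨hz, hy⟩)
  refine hasFDerivAt_integral_of_dominated_of_fderiv_le (bound := fun _ => M)
    (closedBall_mem_nhds z (half_pos hr)) ?_ ?_ ?_ ?_ ?_ ?_
  · filter_upwards [hO.mem_nhds hz] with w hw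
    exact (hsl w hw).aestronglyMeasurable hK.measurableSet
  · exact (hsl z hz).integrableOn_compact hK
  · exact (hsl' z hz).aestronglyMeasurable hK.measurableSet
  · filter_upwards [ae_restrict_mem hK.measurableSet] with y hy w hw
    exact hM (w, y) ⟨hw, hy⟩
  · exact integrableOn_const hK.measure_lt_top.ne
  · filter_upwards [ae_restrict_mem hK.measurableSet] with y hy w hw
    exact hd w (h1 hw) y hy

end Param

section Kernel

set_option linter.unusedSectionVars false
set_option maxSynthPendingDepth 3

variable {n : ℕ}

/-- The mollifier. -/
noncomputable def moll (n : ℕ) : EuclideanSpace ℝ (Fin n) → ℝ :=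
  (ContDiffBump.mk (c := (0 : EuclideanSpace ℝ (Fin n))) (1/4) (1/2)
    (by norm_num) (by norm_num)).normed volume

lemma moll_contDiff : ContDiff ℝ 1 (moll n) := ContDiffBump.contDiff_normed _ (n := 1)

lemma moll_nonneg (x : EuclideanSpace ℝ (Fin n)) : 0 ≤ moll n x := ContDiffBump.nonneg_normed _ x

lemma moll_integral : ∫ x, moll n x = 1 := ContDiffBump.integral_normed _

lemma moll_tsupport : tsupport (moll n) = closedBall 0 (1/2) := ContDiffBump.tsupport_normed_eq _

lemma moll_compact : HasCompactSupport (moll n) := by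
  rw [HasCompactSupport, moll_tsupport]; exact isCompact_closedBall _ _

lemma moll_zero {x : EuclideanSpace ℝ (Fin n)} (hx : 1/2 < ‖x‖) : moll n x = 0 := by
  apply image_eq_zero_of_notMem_tsupport
  rw [moll_tsupport]; simpa using hx

lemma moll_fderiv_zero {x : EuclideanSpace ℝ (Fin n)} (hx : 1/2 < ‖x‖) : fderiv ℝ (moll n) x = 0 := by
  apply image_eq_zero_of_notMem_tsupport
  intro h
  have := tsupport_fderiv_subset ℝ h
  rw [moll_tsupport] at this
  simp at this
  linarith

lemma moll_bound (n : ℕ) : ∃ M, 0 ≤ M ∧ ∀ x, |moll n x| ≤ M ∧ ‖fderiv ℝ (moll n) x‖ ≤ M := by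
  obtain ⟨M0, h0⟩ := moll_contDiff.continuous.bounded_above_of_compact_support (moll_compact (n := n))
  obtain ⟨M1, h1⟩ := (moll_contDiff.continuous_fderiv (by norm_num)).bounded_above_of_compact_support
    ((moll_compact (n := n)).fderiv ℝ)
  exact ⟨max M0 M1, ((norm_nonneg _).trans (h0 0)).trans (le_max_left _ _), fun x =>
    ⟨(h0 x).trans (le_max_left _ _), (h1 x).trans (le_max_right _ _)⟩⟩

/-- The kernel. -/
noncomputable def ker (z : EuclideanSpace ℝ (Fin (n + 1))) (y : EuclideanSpace ℝ (Fin n)) : ℝ :=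
  ((pt z)⁻¹) ^ n * moll n ((pt z)⁻¹ • (px z - y))

/-- Derivative of the kernel. -/
noncomputable def ker' (z : EuclideanSpace ℝ (Fin (n + 1))) (y : EuclideanSpace ℝ (Fin n)) :
    EuclideanSpace ℝ (Fin (n + 1)) →L[ℝ] ℝ :=
  ((pt z)⁻¹) ^ n • (fderiv ℝ (moll n) ((pt z)⁻¹ • (px z - y))).comp
      ((pt z)⁻¹ • px + ((-((pt z) ^ 2)⁻¹) • pt).smulRight (px z - y))
    + moll n ((pt z)⁻¹ • (px z - y)) • ((n * ((pt z)⁻¹) ^ (n - 1)) • ((-((pt z) ^ 2)⁻¹) • pt))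

lemma ker_hasFDerivAt {z : EuclideanSpace ℝ (Fin (n + 1))} (hz : 0 < pt z)
    (y : EuclideanSpace ℝ (Fin n)) : HasFDerivAt (fun z => ker z y) (ker' z y) z := by
  have h1 : HasFDerivAt (fun z : EuclideanSpace ℝ (Fin (n+1)) => (pt z)⁻¹)
      ((-((pt z) ^ 2)⁻¹) • pt) z :=
    (hasDerivAt_inv hz.ne').comp_hasFDerivAt z (pt.hasFDerivAt)
  have h2 : HasFDerivAt (fun z : EuclideanSpace ℝ (Fin (n+1)) => ((pt z)⁻¹) ^ n)
      ((n * ((pt z)⁻¹) ^ (n - 1)) • ((-((pt z) ^ 2)⁻¹) • pt)) z :=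
    (hasDerivAt_pow n ((pt z)⁻¹)).comp_hasFDerivAt z h1
  have h3 : HasFDerivAt (fun z : EuclideanSpace ℝ (Fin (n+1)) => px z - y) px z :=
    px.hasFDerivAt.sub_const y
  have h4 := h1.smul h3
  have h5 : HasFDerivAt (moll n) (fderiv ℝ (moll n) ((pt z)⁻¹ • (px z - y)))
      ((pt z)⁻¹ • (px z - y)) :=
    (moll_contDiff.differentiable (by norm_num) _).hasFDerivAt
  exact h2.mul (h5.comp z h4)

lemma continuousOn_inv_pt : ContinuousOn
    (fun q : EuclideanSpace ℝ (Fin (n+1)) × EuclideanSpace ℝ (Fin n) => (pt q.1)⁻¹)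
    ({z | 0 < pt z} ×ˢ univ) :=
  ContinuousOn.inv₀ (by fun_prop) (fun q hq => hq.1.ne')

lemma ker_cont : ContinuousOn
    (fun q : EuclideanSpace ℝ (Fin (n+1)) × EuclideanSpace ℝ (Fin n) => ker q.1 q.2)
    ({z | 0 < pt z} ×ˢ univ) := by
  unfold ker
  have h1 := continuousOn_inv_pt (n := n)
  have h2 := (moll_contDiff (n := n)).continuous
  refine (h1.pow n).mul (h2.comp_continuousOn ?_)
  exact h1.smul (by fun_prop)

lemma ker'_cont : ContinuousOn
    (fun q : EuclideanSpace ℝ (Fin (n+1)) × EuclideanSpace ℝ (Fin n) => ker' q.1 q.2)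
    ({z | 0 < pt z} ×ˢ univ) := by
  unfold ker'
  have h1 := continuousOn_inv_pt (n := n)
  have h2 := (moll_contDiff (n := n)).continuous
  have h3 := (moll_contDiff (n := n)).continuous_fderiv (by norm_num)
  have h4 : ContinuousOn (fun q : EuclideanSpace ℝ (Fin (n+1)) × EuclideanSpace ℝ (Fin n) =>
      (pt q.1)⁻¹ • (px q.1 - q.2)) ({z | 0 < pt z} ×ˢ univ) := h1.smul (by fun_prop)
  have h5 : ContinuousOn (fun q : EuclideanSpace ℝ (Fin (n+1)) × EuclideanSpace ℝ (Fin n) =>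
      (-((pt q.1) ^ 2)⁻¹) • (pt : EuclideanSpace ℝ (Fin (n+1)) →L[ℝ] ℝ)) ({z | 0 < pt z} ×ˢ univ) := by
    simp only [← inv_pow]
    exact ((h1.pow 2).neg).smul continuousOn_const
  have h6 : ContinuousOn (fun q : EuclideanSpace ℝ (Fin (n+1)) × EuclideanSpace ℝ (Fin n) =>
      px q.1 - q.2) ({z | 0 < pt z} ×ˢ univ) := by fun_prop
  refine ContinuousOn.add ((h1.pow n).smul (ContinuousOn.clm_comp (h3.comp_continuousOn h4) ?_)) ?_
  · refine (h1.smul continuousOn_const).add ?_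
    exact ((ContinuousLinearMap.smulRightL ℝ (EuclideanSpace ℝ (Fin (n+1)))
      (EuclideanSpace ℝ (Fin n))).continuous.comp_continuousOn h5).clm_apply h6
  · exact (h2.comp_continuousOn h4).smul ((continuousOn_const.mul (h1.pow (n-1))).smul h5)

lemma ker_zero {z : EuclideanSpace ℝ (Fin (n + 1))} (hz : 0 < pt z)
    {y : EuclideanSpace ℝ (Fin n)} (hy : y ∉ closedBall (px z) (pt z / 2)) :
    ker z y = 0 ∧ ker' z y = 0 := by
  have : 1 / 2 < ‖(pt z)⁻¹ • (px z - y)‖ := by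
    rw [norm_smul, Real.norm_of_nonneg (inv_nonneg.mpr hz.le), norm_sub_rev, ← dist_eq_norm]
    rw [mem_closedBall, not_le] at hy
    rw [lt_inv_mul_iff₀ hz]; linarith
  unfold ker ker'
  rw [moll_zero this, moll_fderiv_zero this]
  simp

lemma ker_bound (n : ℕ) : ∃ M, 0 < M ∧ ∀ z : EuclideanSpace ℝ (Fin (n + 1)), 0 < pt z →
    ∀ y, |ker z y| ≤ M * ((pt z)⁻¹) ^ n ∧ ‖ker' z y‖ ≤ M * ((pt z)⁻¹) ^ (n + 1) := by
  obtain ⟨M, hM0, hM⟩ := moll_bound n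
  refine ⟨M * (2 + n) + 1, by positivity, fun z hz y => ⟨?_, ?_⟩⟩
  · unfold ker
    rw [abs_mul, abs_of_nonneg (by positivity), mul_comm]
    gcongr
    refine (hM _).1.trans ?_
    nlinarith [(Nat.cast_nonneg n : (0:ℝ) ≤ n), mul_nonneg hM0 (Nat.cast_nonneg (α := ℝ) n)]
  · by_cases hy : y ∈ closedBall (px z) (pt z / 2)
    · have hτ : 0 < (pt z)⁻¹ := inv_pos.mpr hz
      set τ := (pt z)⁻¹ with hτd
      have hpt : ‖(pt : EuclideanSpace ℝ (Fin (n+1)) →L[ℝ] ℝ)‖ ≤ 1 :=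
        ContinuousLinearMap.opNorm_le_bound _ zero_le_one (fun v => by
          rw [one_mul]; exact abs_pt_le v)
      have hpx : ‖(px : EuclideanSpace ℝ (Fin (n+1)) →L[ℝ] EuclideanSpace ℝ (Fin n))‖ ≤ 1 :=
        ContinuousLinearMap.opNorm_le_bound _ zero_le_one (fun v => by
          rw [one_mul]; exact norm_px_le v)
      have hxy : ‖px z - y‖ ≤ pt z / 2 := by
        rw [mem_closedBall, dist_eq_norm, norm_sub_rev] at hy; exact hy
      have e1 : ‖(-((pt z) ^ 2)⁻¹) • (pt : EuclideanSpace ℝ (Fin (n+1)) →L[ℝ] ℝ)‖ ≤ τ ^ 2 := by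
        rw [norm_smul, norm_neg, ← inv_pow, Real.norm_of_nonneg (by positivity)]
        exact mul_le_of_le_one_right (by positivity) hpt
      have e2 : ‖τ • px + ((-((pt z) ^ 2)⁻¹) • pt).smulRight (px z - y)‖ ≤ 2 * τ := by
        refine (norm_add_le _ _).trans ?_
        rw [norm_smul, ContinuousLinearMap.norm_smulRight_apply, Real.norm_of_nonneg hτ.le]
        have : ‖(-((pt z) ^ 2)⁻¹) • (pt : EuclideanSpace ℝ (Fin (n+1)) →L[ℝ] ℝ)‖ * ‖px z - y‖
            ≤ τ ^ 2 * (pt z / 2) := by gcongr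
        have h3 : τ ^ 2 * (pt z / 2) = τ / 2 := by
          rw [hτd]; field_simp
        nlinarith
      have e3 : ‖(n * τ ^ (n - 1)) • ((-((pt z) ^ 2)⁻¹) • (pt : EuclideanSpace ℝ (Fin (n+1)) →L[ℝ] ℝ))‖
          ≤ n * τ ^ (n + 1) := by
        rw [norm_smul, Real.norm_of_nonneg (by positivity)]
        rcases n with _ | m
        · simp
        · calc _ ≤ ((m + 1 : ℕ) : ℝ) * τ ^ (m + 1 - 1) * τ ^ 2 := by gcongr
            _ = _ := by simp only [Nat.add_sub_cancel]; ring
      unfold ker'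
      rw [← hτd]
      calc _ ≤ τ ^ n * (M * (2 * τ)) + M * (n * τ ^ (n + 1)) := by
            refine (norm_add_le _ _).trans ?_
            gcongr
            · rw [norm_smul, Real.norm_of_nonneg (by positivity)]
              gcongr
              refine (ContinuousLinearMap.opNorm_comp_le _ _).trans ?_
              gcongr
              exact (hM _).2
            · rw [norm_smul]
              gcongr
              exact (hM _).1
        _ = (M * (2 + n)) * τ ^ (n + 1) := by ring
        _ ≤ _ := by gcongr; linarith
    · rw [(ker_zero hz hy).2, norm_zero]; positivity

lemma ker_change {F : Type*} [NormedAddCommGroup F] [NormedSpace ℝ F]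
    {z : EuclideanSpace ℝ (Fin (n + 1))} (hz : 0 < pt z) (f : EuclideanSpace ℝ (Fin n) → F) :
    ∫ y, ker z y • f y = ∫ h, moll n h • f (px z - pt z • h) := by
  rw [← integral_sub_left_eq_self _ _ (px z)]
  have h1 := MeasureTheory.Measure.integral_comp_smul (volume : Measure (EuclideanSpace ℝ (Fin n)))
    (fun y => ker z (px z - y) • f (px z - y)) (pt z)
  rw [finrank_euclideanSpace_fin, abs_of_nonneg (by positivity), eq_comm, inv_smul_eq_iff₀ (by positivity)] at h1
  rw [h1, ← integral_smul]
  congr 1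
  ext h
  unfold ker
  rw [sub_sub_cancel, inv_smul_smul₀ hz.ne', smul_smul, ← mul_assoc, inv_pow,
    mul_inv_cancel₀ (by positivity), one_mul]

lemma ker_integral {z : EuclideanSpace ℝ (Fin (n + 1))} (hz : 0 < pt z) :
    ∫ y, ker z y = 1 := by
  have := ker_change hz (fun _ => (1:ℝ))
  simp only [smul_eq_mul, mul_one] at this
  rw [this, moll_integral]

end Kernel

section Averages

set_option linter.unusedSectionVars false
set_option maxSynthPendingDepth 3

variable {n : ℕ} {F : Type*} [NormedAddCommGroup F] [InnerProductSpace ℝ F]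
  [FiniteDimensional ℝ F] [CompleteSpace F]

/-- Covariant average, in convolution form. -/
noncomputable def Vf (R : ℝ) (Rt : EuclideanSpace ℝ (Fin n) → EuclideanSpace ℝ (Fin n) → F →L[ℝ] F)
    (u : EuclideanSpace ℝ (Fin n) → F) (z : EuclideanSpace ℝ (Fin (n + 1))) : F :=
  ∫ y in closedBall 0 (3 * R / 2), ker z y • Rt (px z) y (u y)

/-- Integrand of the derivative of the covariant average. -/
noncomputable def dV
    (Rt : EuclideanSpace ℝ (Fin n) → EuclideanSpace ℝ (Fin n) → F →L[ℝ] F)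
    (DR : EuclideanSpace ℝ (Fin n) → EuclideanSpace ℝ (Fin n) →
      EuclideanSpace ℝ (Fin n) →L[ℝ] F →L[ℝ] F)
    (u : EuclideanSpace ℝ (Fin n) → F) (z : EuclideanSpace ℝ (Fin (n + 1)))
    (y : EuclideanSpace ℝ (Fin n)) : EuclideanSpace ℝ (Fin (n + 1)) →L[ℝ] F :=
  ker z y • ((DR (px z) y).comp px).flip (u y) + (ker' z y).smulRight (Rt (px z) y (u y))

/-- Derivative of the covariant average. -/
noncomputable def DVf (R : ℝ)
    (Rt : EuclideanSpace ℝ (Fin n) → EuclideanSpace ℝ (Fin n) → F →L[ℝ] F)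
    (DR : EuclideanSpace ℝ (Fin n) → EuclideanSpace ℝ (Fin n) →
      EuclideanSpace ℝ (Fin n) →L[ℝ] F →L[ℝ] F)
    (u : EuclideanSpace ℝ (Fin n) → F) (z : EuclideanSpace ℝ (Fin (n + 1))) :
    EuclideanSpace ℝ (Fin (n + 1)) →L[ℝ] F :=
  ∫ y in closedBall 0 (3 * R / 2), dV Rt DR u z y

/-- Covariant average, in scaled form. -/
noncomputable def V0 (Rt : EuclideanSpace ℝ (Fin n) → EuclideanSpace ℝ (Fin n) → F →L[ℝ] F)
    (u : EuclideanSpace ℝ (Fin n) → F) (z : EuclideanSpace ℝ (Fin (n + 1))) : F :=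
  ∫ h in closedBall 0 (1 / 2), moll n h • Rt (px z) (px z - pt z • h) (u (px z - pt z • h))

variable {R κ : ℝ}
  {Γ : EuclideanSpace ℝ (Fin (n + 1)) → EuclideanSpace ℝ (Fin (n + 1)) →L[ℝ] F →L[ℝ] F}
  {Rt : EuclideanSpace ℝ (Fin n) → EuclideanSpace ℝ (Fin n) → F →L[ℝ] F}
  {DR : EuclideanSpace ℝ (Fin n) → EuclideanSpace ℝ (Fin n) →
      EuclideanSpace ℝ (Fin n) →L[ℝ] F →L[ℝ] F}
  {u : EuclideanSpace ℝ (Fin n) → F}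

lemma K_sub (hR : 0 < R) : closedBall (0 : EuclideanSpace ℝ (Fin n)) (3 * R / 2) ⊆ ball 0 (2 * R) :=
  closedBall_subset_ball (by linarith)

lemma D_sub {z : EuclideanSpace ℝ (Fin (n + 1))} (hz : z ∈ openCylinder n R R) :
    closedBall (px z) (pt z / 2) ⊆ closedBall 0 (3 * R / 2) := by
  rw [mem_openCylinder] at hz
  refine closedBall_subset_closedBall' ?_
  rw [dist_zero_right]; linarith [hz.1, hz.2.2]

lemma px_mem (hR : 0 < R) {z : EuclideanSpace ℝ (Fin (n + 1))} (hz : z ∈ openCylinder n R R) :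
    px z ∈ ball 0 (2 * R) := by
  rw [mem_openCylinder] at hz
  rw [mem_ball, dist_zero_right]; linarith [hz.1]

lemma HT.cRt (hR : 0 < R) (h : HT R κ Γ Rt DR) : ContinuousOn
    (fun q : EuclideanSpace ℝ (Fin (n+1)) × EuclideanSpace ℝ (Fin n) => Rt (px q.1) q.2)
    (openCylinder n R R ×ˢ closedBall 0 (3 * R / 2)) :=
  h.c0.comp (f := fun q : EuclideanSpace ℝ (Fin (n+1)) × EuclideanSpace ℝ (Fin n) => (px q.1, q.2))
    (by fun_prop) (fun q hq => ⟨px_mem hR hq.1, K_sub hR hq.2⟩)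

lemma HT.cDR (hR : 0 < R) (h : HT R κ Γ Rt DR) : ContinuousOn
    (fun q : EuclideanSpace ℝ (Fin (n+1)) × EuclideanSpace ℝ (Fin n) => DR (px q.1) q.2)
    (openCylinder n R R ×ˢ closedBall 0 (3 * R / 2)) :=
  h.c1.comp (f := fun q : EuclideanSpace ℝ (Fin (n+1)) × EuclideanSpace ℝ (Fin n) => (px q.1, q.2))
    (by fun_prop) (fun q hq => ⟨px_mem hR hq.1, K_sub hR hq.2⟩)

lemma ker_sub : openCylinder n R R ×ˢ closedBall (0 : EuclideanSpace ℝ (Fin n)) (3 * R / 2)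
    ⊆ {z | 0 < pt z} ×ˢ univ :=
  fun q hq => ⟨(mem_openCylinder.mp hq.1).2.1, mem_univ _⟩

lemma cont_u (hR : 0 < R) (hu : ContinuousOn u (ball 0 (2 * R))) : ContinuousOn
    (fun q : EuclideanSpace ℝ (Fin (n+1)) × EuclideanSpace ℝ (Fin n) => u q.2)
    (openCylinder n R R ×ˢ closedBall 0 (3 * R / 2)) :=
  hu.comp continuousOn_snd (fun _ hq => K_sub hR hq.2)

lemma cont_V (hR : 0 < R) (h : HT R κ Γ Rt DR) (hu : ContinuousOn u (ball 0 (2 * R))) :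
    ContinuousOn (fun q : EuclideanSpace ℝ (Fin (n+1)) × EuclideanSpace ℝ (Fin n) =>
      ker q.1 q.2 • Rt (px q.1) q.2 (u q.2))
    (openCylinder n R R ×ˢ closedBall 0 (3 * R / 2)) :=
  (ker_cont.mono ker_sub).smul ((h.cRt hR).clm_apply (cont_u hR hu))

lemma cont_dV (hR : 0 < R) (h : HT R κ Γ Rt DR) (hu : ContinuousOn u (ball 0 (2 * R))) :
    ContinuousOn (fun q : EuclideanSpace ℝ (Fin (n+1)) × EuclideanSpace ℝ (Fin n) =>
      dV Rt DR u q.1 q.2)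
    (openCylinder n R R ×ˢ closedBall 0 (3 * R / 2)) := by
  unfold dV
  refine ((ker_cont.mono ker_sub).smul ?_).add ?_
  · have h1 : ContinuousOn (fun q : EuclideanSpace ℝ (Fin (n+1)) × EuclideanSpace ℝ (Fin n) =>
      ((DR (px q.1) q.2).comp px)) (openCylinder n R R ×ˢ closedBall 0 (3 * R / 2)) :=
      (h.cDR hR).clm_comp continuousOn_const
    have h2 := (ContinuousLinearMap.flipₗᵢ ℝ (EuclideanSpace ℝ (Fin (n+1))) F F).continuous.comp_continuousOn h1
    exact h2.clm_apply (cont_u hR hu)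
  · exact ((ContinuousLinearMap.smulRightL ℝ (EuclideanSpace ℝ (Fin (n+1))) F).continuous.comp_continuousOn
      (ker'_cont.mono ker_sub)).clm_apply ((h.cRt hR).clm_apply (cont_u hR hu))

lemma Vf_hasFDerivAt (hR : 0 < R) (h : HT R κ Γ Rt DR) (hu : ContinuousOn u (ball 0 (2 * R)))
    {z : EuclideanSpace ℝ (Fin (n + 1))} (hz : z ∈ openCylinder n R R) :
    HasFDerivAt (Vf R Rt u) (DVf R Rt DR u z) z := by
  refine param_deriv (isOpen_openCylinder R R) (isCompact_closedBall _ _) (cont_V hR h hu)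
    (cont_dV hR h hu) ?_ hz
  intro z hz y hy
  have h1 : HasFDerivAt (fun z : EuclideanSpace ℝ (Fin (n + 1)) => Rt (px z) y)
      ((DR (px z) y).comp px) z :=
    (h.der (px z) (px_mem hR hz) y (K_sub hR hy)).comp z px.hasFDerivAt
  have h2 : HasFDerivAt (fun z : EuclideanSpace ℝ (Fin (n + 1)) => Rt (px z) y (u y))
      (((DR (px z) y).comp px).flip (u y)) z := by
    have := h1.clm_apply (hasFDerivAt_const (u y) z)
    refine this.congr_fderiv ?_
    simp
  exact (ker_hasFDerivAt (mem_openCylinder.mp hz).2.1 y).smul h2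

lemma DVf_cont (hR : 0 < R) (h : HT R κ Γ Rt DR) (hu : ContinuousOn u (ball 0 (2 * R))) :
    ContinuousOn (DVf R Rt DR u) (openCylinder n R R) :=
  param_cont_open (isOpen_openCylinder R R) (isCompact_closedBall _ _) (cont_dV hR h hu)

lemma V0_eq {z : EuclideanSpace ℝ (Fin (n + 1))} (hz : z ∈ openCylinder n R R) :
    V0 Rt u z = Vf R Rt u z := by
  have ht := (mem_openCylinder.mp hz).2.1
  unfold V0 Vf
  rw [setIntegral_eq_integral_of_forall_compl_eq_zero,
    setIntegral_eq_integral_of_forall_compl_eq_zero]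
  · exact (ker_change ht (fun y => Rt (px z) y (u y))).symm
  · intro y hy
    rw [(ker_zero ht (fun hm => hy (D_sub hz hm))).1, zero_smul]
  · intro h hh
    rw [moll_zero (by simpa using hh), zero_smul]

lemma V0_cont (hR : 0 < R) (h : HT R κ Γ Rt DR) (hu : ContinuousOn u (ball 0 (2 * R))) :
    ContinuousOn (V0 Rt u) (closedCylinder n R R) := by
  refine param_cont (isCompact_closedCylinder R R) (isCompact_closedBall _ _) ?_
  have hmem : ∀ q ∈ closedCylinder n R R ×ˢ closedBall (0 : EuclideanSpace ℝ (Fin n)) (1 / 2),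
      px q.1 ∈ ball (0 : EuclideanSpace ℝ (Fin n)) (2 * R) ∧
      px q.1 - pt q.1 • q.2 ∈ ball (0 : EuclideanSpace ℝ (Fin n)) (2 * R) := by
    rintro ⟨z, h⟩ ⟨hz, hh⟩
    rw [mem_closedCylinder] at hz
    simp only [mem_ball, dist_zero_right, mem_closedBall] at hh ⊢
    refine ⟨by linarith [hz.1], ?_⟩
    refine (norm_sub_le _ _).trans_lt ?_
    rw [norm_smul, Real.norm_of_nonneg hz.2.1]
    nlinarith [hz.1, hz.2.1, hz.2.2, norm_nonneg h]
  have c1 : ContinuousOn (fun q : EuclideanSpace ℝ (Fin (n+1)) × EuclideanSpace ℝ (Fin n) =>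
      Rt (px q.1) (px q.1 - pt q.1 • q.2)) (closedCylinder n R R ×ˢ closedBall 0 (1 / 2)) :=
    h.c0.comp (f := fun q : EuclideanSpace ℝ (Fin (n+1)) × EuclideanSpace ℝ (Fin n) =>
      (px q.1, px q.1 - pt q.1 • q.2)) (by fun_prop) (fun q hq => hmem q hq)
  have c2 : ContinuousOn (fun q : EuclideanSpace ℝ (Fin (n+1)) × EuclideanSpace ℝ (Fin n) =>
      u (px q.1 - pt q.1 • q.2)) (closedCylinder n R R ×ˢ closedBall 0 (1 / 2)) :=
    hu.comp (by fun_prop) (fun q hq => (hmem q hq).2)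
  have c3 : ContinuousOn (fun q : EuclideanSpace ℝ (Fin (n+1)) × EuclideanSpace ℝ (Fin n) =>
      moll n q.2) (closedCylinder n R R ×ˢ closedBall 0 (1 / 2)) :=
    (moll_contDiff.continuous.comp continuous_snd).continuousOn
  exact c3.smul (c1.clm_apply c2)

lemma V0_bottom (h : HT R κ Γ Rt DR) {x : EuclideanSpace ℝ (Fin n)} (hx : x ∈ ball 0 (2 * R)) :
    V0 Rt u (io x) = u x := by
  unfold V0
  simp only [io_apply, px_emb, pt_emb, zero_smul, sub_zero, h.diag x hx]
  rw [integral_smul_const, setIntegral_eq_integral_of_forall_compl_eq_zero, moll_integral, one_smul]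
  · rfl
  · intro h hh
    exact moll_zero (by simpa using hh)

lemma setInt_bound {f : EuclideanSpace ℝ (Fin n) → F} {g : EuclideanSpace ℝ (Fin n) → ℝ}
    {K D : Set (EuclideanSpace ℝ (Fin n))} (hK : MeasurableSet K) (hDm : MeasurableSet D)
    (hD : D ⊆ K) (hg : IntegrableOn g D)
    (h1 : ∀ y ∈ D, ‖f y‖ ≤ g y) (h2 : ∀ y ∉ D, f y = 0) :
    ‖∫ y in K, f y‖ ≤ ∫ y in D, g y := by
  have : ∫ y in D, g y = ∫ y in K, D.indicator g y := by
    rw [setIntegral_indicator hDm, inter_eq_self_of_subset_right hD]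
  rw [this]
  refine norm_integral_le_of_norm_le ?_ ?_
  · exact ((integrable_indicator_iff hDm).mpr hg).integrableOn
  · refine Filter.Eventually.of_forall (fun y => ?_)
    by_cases hy : y ∈ D
    · rw [indicator_of_mem hy]; exact h1 y hy
    · rw [indicator_of_notMem hy, h2 y hy, norm_zero]

/-- The constant in the kernel bounds. -/
def KB (n : ℕ) (M : ℝ) : Prop := ∀ z : EuclideanSpace ℝ (Fin (n + 1)), 0 < pt z →
    ∀ y, |ker z y| ≤ M * ((pt z)⁻¹) ^ n ∧ ‖ker' z y‖ ≤ M * ((pt z)⁻¹) ^ (n + 1)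

lemma Vf_bound (hR : 0 < R) (h : HT R κ Γ Rt DR) (hu : ContinuousOn u (ball 0 (2 * R)))
    {M : ℝ} (hM : KB n M) {z : EuclideanSpace ℝ (Fin (n + 1))} (hz : z ∈ openCylinder n R R) :
    ‖Vf R Rt u z‖ ≤ M * ((pt z)⁻¹) ^ n * ∫ y in closedBall (px z) (pt z / 2), ‖u y‖ := by
  have ht := (mem_openCylinder.mp hz).2.1
  rw [← integral_const_mul]
  have hDK := D_sub hz
  refine setInt_bound measurableSet_closedBall measurableSet_closedBall hDK ?_ ?_ ?_
  · refine ContinuousOn.integrableOn_compact (isCompact_closedBall _ _) ?_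
    exact continuousOn_const.mul (hu.mono (hDK.trans (K_sub hR))).norm
  · intro y hy
    rw [norm_smul, h.iso _ (px_mem hR hz) _ (K_sub hR (hDK hy))]
    gcongr
    exact (hM z ht y).1
  · intro y hy
    rw [(ker_zero ht hy).1, zero_smul]

lemma ker'_integral {z : EuclideanSpace ℝ (Fin (n + 1))} (hz : z ∈ openCylinder n R R) :
    ∫ y in closedBall 0 (3 * R / 2), ker' z y = 0 := by
  have h1 : HasFDerivAt (fun z => ∫ y in closedBall 0 (3 * R / 2), ker z y)
      (∫ y in closedBall 0 (3 * R / 2), ker' z y) z :=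
    param_deriv (isOpen_openCylinder (n := n) R R) (isCompact_closedBall _ _) (ker_cont.mono ker_sub)
      (ker'_cont.mono ker_sub)
      (fun z hz y _ => ker_hasFDerivAt (mem_openCylinder.mp hz).2.1 y) hz
  have h2 : HasFDerivAt (fun z : EuclideanSpace ℝ (Fin (n + 1)) =>
      ∫ y in closedBall 0 (3 * R / 2), ker z y) (0 : EuclideanSpace ℝ (Fin (n + 1)) →L[ℝ] ℝ) z := by
    refine (hasFDerivAt_const (1:ℝ) z).congr_of_eventuallyEq ?_
    filter_upwards [(isOpen_openCylinder R R).mem_nhds hz] with w hw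
    rw [setIntegral_eq_integral_of_forall_compl_eq_zero, ker_integral (mem_openCylinder.mp hw).2.1]
    intro y hy
    exact (ker_zero (mem_openCylinder.mp hw).2.1 (fun hm => hy (D_sub hw hm))).1
  exact h1.unique h2

lemma slice_cont {G : Type*} [TopologicalSpace G]
    {f : EuclideanSpace ℝ (Fin (n+1)) → EuclideanSpace ℝ (Fin n) → G}
    (hf : ContinuousOn (fun q : EuclideanSpace ℝ (Fin (n+1)) × EuclideanSpace ℝ (Fin n) =>
      f q.1 q.2) (openCylinder n R R ×ˢ closedBall 0 (3 * R / 2)))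
    {z : EuclideanSpace ℝ (Fin (n + 1))} (hz : z ∈ openCylinder n R R) :
    ContinuousOn (f z) (closedBall 0 (3 * R / 2)) :=
  hf.comp (f := fun y => (z, y)) (by fun_prop) (fun y hy => ⟨hz, hy⟩)

lemma DVf_bound (hR : 0 < R) (h : HT R κ Γ Rt DR) (hu : ContinuousOn u (ball 0 (2 * R)))
    (hκ : 0 ≤ κ)
    {M : ℝ} (hM : KB n M) {z : EuclideanSpace ℝ (Fin (n + 1))} (hz : z ∈ openCylinder n R R)
    (v : EuclideanSpace ℝ (Fin (n + 1))) :
    ‖DVf R Rt DR u z v + Γ (io (px z)) (io (px v)) (Vf R Rt u z)‖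
      ≤ ‖v‖ * (M * ((pt z)⁻¹) ^ (n + 1) *
          (∫ y in closedBall (px z) (pt z / 2), ‖u (px z) - Rt (px z) y (u y)‖)
        + M * ((pt z)⁻¹) ^ n * (κ * pt z) * ∫ y in closedBall (px z) (pt z / 2), ‖u y‖) := by
  have ht := (mem_openCylinder.mp hz).2.1
  have hDK := D_sub hz
  set K := closedBall (0 : EuclideanSpace ℝ (Fin n)) (3 * R / 2) with hKd
  have hKc : IsCompact K := isCompact_closedBall _ _
  set T := Γ (io (px z)) (io (px v)) with hT
  have i1 : IntegrableOn (fun y => dV Rt DR u z y) K :=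
    (slice_cont (cont_dV hR h hu) hz).integrableOn_compact hKc
  have i2 : IntegrableOn (fun y => ker z y • Rt (px z) y (u y)) K :=
    (slice_cont (f := fun z y => ker z y • Rt (px z) y (u y)) (cont_V hR h hu) hz).integrableOn_compact hKc
  have i3 : IntegrableOn (fun y => ker' z y) K :=
    (slice_cont (ker'_cont.mono ker_sub) hz).integrableOn_compact hKc
  have i4 : IntegrableOn (fun y => ker' z y v • u (px z)) K :=
    (i3.apply_continuousLinearMap v).smul_const (u (px z))
  have e1 : DVf R Rt DR u z v = ∫ y in K, dV Rt DR u z y v :=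
    ContinuousLinearMap.integral_apply i1 v
  have e2 : T (Vf R Rt u z) = ∫ y in K, T (ker z y • Rt (px z) y (u y)) :=
    (T.integral_comp_comm i2).symm
  have e3 : ∫ y in K, ker' z y v • u (px z) = 0 := by
    rw [integral_smul_const, ← ContinuousLinearMap.integral_apply i3 v, ker'_integral hz]
    simp
  have j1 : IntegrableOn (fun y => dV Rt DR u z y v) K := i1.apply_continuousLinearMap v
  have j2 : IntegrableOn (fun y => T (ker z y • Rt (px z) y (u y))) K := T.integrable_comp i2
  have e4 : DVf R Rt DR u z v + T (Vf R Rt u z)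
      = ∫ y in K, (dV Rt DR u z y v + T (ker z y • Rt (px z) y (u y)) - ker' z y v • u (px z)) := by
    have j3 : IntegrableOn (fun y => dV Rt DR u z y v + T (ker z y • Rt (px z) y (u y))) K :=
      j1.add j2
    rw [integral_sub j3 i4, integral_add j1 j2, e3, sub_zero, e1, e2]
  have cu : ContinuousOn u (closedBall (px z) (pt z / 2)) := hu.mono (hDK.trans (K_sub hR))
  have cR : ContinuousOn (Rt (px z)) (closedBall (px z) (pt z / 2)) :=
    (slice_cont (f := fun z y => Rt (px z) y) (h.cRt hR) hz).mono hDK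
  have k1 : IntegrableOn (fun y => ‖u (px z) - Rt (px z) y (u y)‖) (closedBall (px z) (pt z / 2)) :=
    ContinuousOn.integrableOn_compact (isCompact_closedBall _ _)
      (continuousOn_const.sub (cR.clm_apply cu)).norm
  have k2 : IntegrableOn (fun y => ‖u y‖) (closedBall (px z) (pt z / 2)) :=
    ContinuousOn.integrableOn_compact (isCompact_closedBall _ _) cu.norm
  rw [e4, ← integral_const_mul, ← integral_const_mul, ← integral_add (k1.const_mul _) (k2.const_mul _),
    ← integral_const_mul]
  refine setInt_bound measurableSet_closedBall measurableSet_closedBall hDK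
    (((k1.const_mul _).add (k2.const_mul _)).const_mul _) ?_ ?_
  · intro y hy
    have hyB := K_sub hR (hDK hy)
    have hxy : ‖px z - y‖ ≤ pt z := by
      rw [mem_closedBall, dist_eq_norm, norm_sub_rev] at hy; linarith
    have e5 : dV Rt DR u z y v + T (ker z y • Rt (px z) y (u y)) - ker' z y v • u (px z)
        = - (ker' z y v • (u (px z) - Rt (px z) y (u y)))
          + ker z y • ((DR (px z) y (px v) + T * Rt (px z) y) (u y)) := by
      have : dV Rt DR u z y v = ker z y • (DR (px z) y (px v)) (u y)
        + ker' z y v • (Rt (px z) y (u y)) := rfl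
      rw [this, map_smul, smul_sub, add_apply, smul_add]
      have : (T * Rt (px z) y) (u y) = T (Rt (px z) y (u y)) := rfl
      rw [this]; abel
    rw [e5]
    have hk := hM z ht y
    have b1 : ‖ker' z y v‖ ≤ M * ((pt z)⁻¹) ^ (n + 1) * ‖v‖ :=
      ((ker' z y).le_opNorm v).trans (by gcongr; exact hk.2)
    have b2 : ‖(DR (px z) y (px v) + T * Rt (px z) y) (u y)‖ ≤ κ * ‖v‖ * pt z * ‖u y‖ := by
      refine (ContinuousLinearMap.le_opNorm _ _).trans ?_
      gcongr
      refine (h.bd _ (px_mem hR hz) _ hyB (px v)).trans ?_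
      gcongr
      exact norm_px_le v
    have hM' : 0 ≤ M * ((pt z)⁻¹) ^ n := (abs_nonneg _).trans hk.1
    calc _ ≤ (M * ((pt z)⁻¹) ^ (n + 1) * ‖v‖) * ‖u (px z) - Rt (px z) y (u y)‖
          + (M * ((pt z)⁻¹) ^ n) * (κ * ‖v‖ * pt z * ‖u y‖) := by
          refine (norm_add_le _ _).trans ?_
          rw [norm_neg, norm_smul, norm_smul]
          gcongr
          exact hk.1
      _ = _ := by ring
  · intro y hy
    have hk := ker_zero ht hy
    unfold dV
    rw [hk.1, hk.2]
    simp

end Averages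

section Extension

set_option linter.unusedSectionVars false
set_option maxSynthPendingDepth 3

/-- The bump used for the cutoff. -/
noncomputable def thB : ContDiffBump (0 : ℝ) := ContDiffBump.mk (1/2) 1 (by norm_num) (by norm_num)

/-- The cutoff. -/
noncomputable def th (r : ℝ) : ℝ := thB r

lemma th_contDiff : ContDiff ℝ 1 th := ContDiffBump.contDiff thB (n := 1)

lemma th_zero : th 0 = 1 := thB.one_of_mem_closedBall (by simp [thB])

lemma th_nonneg (r : ℝ) : 0 ≤ th r := thB.nonneg

lemma th_le_one (r : ℝ) : th r ≤ 1 := thB.le_one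

lemma th_tsupport : tsupport th = closedBall 0 1 := thB.tsupport_eq

lemma th_out {r : ℝ} (hr : 1 < r) : th r = 0 ∧ deriv th r = 0 := by
  have h0 : r ∉ tsupport th := by
    rw [th_tsupport]; simp only [mem_closedBall, dist_zero_right, Real.norm_eq_abs, not_le]
    exact hr.trans_le (le_abs_self r)
  exact ⟨image_eq_zero_of_notMem_tsupport h0,
    image_eq_zero_of_notMem_tsupport (fun h => h0 (tsupport_deriv_subset h))⟩

lemma th_bound : ∃ M, 0 ≤ M ∧ ∀ r, |deriv th r| ≤ M := by
  have hc : HasCompactSupport th := by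
    rw [HasCompactSupport, th_tsupport]; exact isCompact_closedBall _ _
  obtain ⟨M, hM⟩ := (th_contDiff.continuous_deriv le_rfl).bounded_above_of_compact_support hc.deriv
  exact ⟨M, (norm_nonneg _).trans (hM 0), hM⟩

variable {n : ℕ} {F : Type*} [NormedAddCommGroup F] [InnerProductSpace ℝ F]
  [FiniteDimensional ℝ F] [CompleteSpace F]

/-- The extension. -/
noncomputable def Uf (c : ℝ) (g : EuclideanSpace ℝ (Fin (n + 1)) → F →L[ℝ] F)
    (Rt : EuclideanSpace ℝ (Fin n) → EuclideanSpace ℝ (Fin n) → F →L[ℝ] F)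
    (u : EuclideanSpace ℝ (Fin n) → F) (z : EuclideanSpace ℝ (Fin (n + 1))) : F :=
  th (c * pt z) • g z (V0 Rt u z)

/-- The derivative of the extension. -/
noncomputable def DUf (R c : ℝ) (g : EuclideanSpace ℝ (Fin (n + 1)) → F →L[ℝ] F)
    (Dg : EuclideanSpace ℝ (Fin (n + 1)) → EuclideanSpace ℝ (Fin (n + 1)) →L[ℝ] F →L[ℝ] F)
    (Rt : EuclideanSpace ℝ (Fin n) → EuclideanSpace ℝ (Fin n) → F →L[ℝ] F)
    (DR : EuclideanSpace ℝ (Fin n) → EuclideanSpace ℝ (Fin n) →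
      EuclideanSpace ℝ (Fin n) →L[ℝ] F →L[ℝ] F)
    (u : EuclideanSpace ℝ (Fin n) → F) (z : EuclideanSpace ℝ (Fin (n + 1))) :
    EuclideanSpace ℝ (Fin (n + 1)) →L[ℝ] F :=
  th (c * pt z) • ((g z).comp (DVf R Rt DR u z) + (Dg z).flip (V0 Rt u z))
    + (deriv th (c * pt z) • (c • pt)).smulRight (g z (V0 Rt u z))

variable {R κ c : ℝ}
  {Γ : EuclideanSpace ℝ (Fin (n + 1)) → EuclideanSpace ℝ (Fin (n + 1)) →L[ℝ] F →L[ℝ] F}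
  {g : EuclideanSpace ℝ (Fin (n + 1)) → F →L[ℝ] F}
  {Dg : EuclideanSpace ℝ (Fin (n + 1)) → EuclideanSpace ℝ (Fin (n + 1)) →L[ℝ] F →L[ℝ] F}
  {Rt : EuclideanSpace ℝ (Fin n) → EuclideanSpace ℝ (Fin n) → F →L[ℝ] F}
  {DR : EuclideanSpace ℝ (Fin n) → EuclideanSpace ℝ (Fin n) →
      EuclideanSpace ℝ (Fin n) →L[ℝ] F →L[ℝ] F}
  {u : EuclideanSpace ℝ (Fin n) → F}

lemma oc_sub (hR : 0 < R) : openCylinder n R R ⊆ openCylinder n (2 * R) R := fun z hz => by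
  rw [mem_openCylinder] at *
  exact ⟨by linarith [hz.1], hz.2⟩

lemma cc_sub (hR : 0 < R) : closedCylinder n R R ⊆ closedCylinder n (2 * R) R := fun z hz => by
  rw [mem_closedCylinder] at *
  exact ⟨by linarith [hz.1], hz.2⟩

lemma oc_cc : openCylinder n R R ⊆ closedCylinder n R R := fun z hz => by
  rw [mem_closedCylinder]; rw [mem_openCylinder] at hz
  exact ⟨hz.1.le, hz.2.1.le, hz.2.2.le⟩

lemma Uf_hasFDerivAt (hR : 0 < R) (h : HT R κ Γ Rt DR) (hv : VT R κ Γ g Dg)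
    (hu : ContinuousOn u (ball 0 (2 * R)))
    {z : EuclideanSpace ℝ (Fin (n + 1))} (hz : z ∈ openCylinder n R R) :
    HasFDerivAt (Uf c g Rt u) (DUf R c g Dg Rt DR u z) z := by
  have h1 : HasFDerivAt (V0 Rt u) (DVf R Rt DR u z) z := by
    refine (Vf_hasFDerivAt hR h hu hz).congr_of_eventuallyEq ?_
    filter_upwards [(isOpen_openCylinder R R).mem_nhds hz] with w hw using V0_eq hw
  have h2 := (hv.der z (oc_sub hR hz)).clm_apply h1
  have h3 : HasFDerivAt (fun z : EuclideanSpace ℝ (Fin (n + 1)) => c * pt z) (c • pt) z :=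
    pt.hasFDerivAt.const_mul c
  have h4 : HasDerivAt th (deriv th (c * pt z)) (c * pt z) :=
    (th_contDiff.differentiable (by norm_num) _).hasDerivAt
  have h5 := h4.comp_hasFDerivAt z h3
  exact h5.smul h2

lemma Uf_cont (hR : 0 < R) (h : HT R κ Γ Rt DR) (hv : VT R κ Γ g Dg)
    (hu : ContinuousOn u (ball 0 (2 * R))) : ContinuousOn (Uf c g Rt u) (closedCylinder n R R) := by
  have h1 := V0_cont hR h hu
  have h2 := hv.c0.mono (cc_sub hR)
  have h3 : ContinuousOn (fun z : EuclideanSpace ℝ (Fin (n + 1)) => th (c * pt z))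
      (closedCylinder n R R) :=
    (th_contDiff.continuous.comp (by fun_prop : Continuous
      (fun z : EuclideanSpace ℝ (Fin (n + 1)) => c * pt z))).continuousOn
  exact h3.smul (h2.clm_apply h1)

lemma DUf_cont (hR : 0 < R) (h : HT R κ Γ Rt DR) (hv : VT R κ Γ g Dg)
    (hu : ContinuousOn u (ball 0 (2 * R))) :
    ContinuousOn (DUf R c g Dg Rt DR u) (openCylinder n R R) := by
  have h1 := (V0_cont hR h hu).mono oc_cc
  have h2 := hv.c0.mono ((oc_cc).trans (cc_sub hR))
  have h2' := hv.c1.mono (oc_sub hR)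
  have h4 : Continuous (fun z : EuclideanSpace ℝ (Fin (n + 1)) => c * pt z) := by fun_prop
  have h3 : ContinuousOn (fun z : EuclideanSpace ℝ (Fin (n + 1)) => th (c * pt z))
      (openCylinder n R R) :=
    (th_contDiff.continuous.comp h4).continuousOn
  have h3' : ContinuousOn (fun z : EuclideanSpace ℝ (Fin (n + 1)) => deriv th (c * pt z))
      (openCylinder n R R) :=
    ((th_contDiff.continuous_deriv le_rfl).comp h4).continuousOn
  have h5 := DVf_cont hR h hu
  unfold DUf
  refine (h3.smul ((h2.clm_comp h5).add ?_)).add ?_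
  · exact ((ContinuousLinearMap.flipₗᵢ ℝ (EuclideanSpace ℝ (Fin (n+1))) F F).continuous.comp_continuousOn
      h2').clm_apply h1
  · have h6 : ContinuousOn (fun z : EuclideanSpace ℝ (Fin (n + 1)) =>
      deriv th (c * pt z) • (c • (pt : EuclideanSpace ℝ (Fin (n + 1)) →L[ℝ] ℝ))) (openCylinder n R R) :=
      h3'.smul continuousOn_const
    exact ((ContinuousLinearMap.smulRightL ℝ (EuclideanSpace ℝ (Fin (n+1))) F).continuous.comp_continuousOn
      h6).clm_apply (h2.clm_apply h1)

lemma Uf_bottom (h : HT R κ Γ Rt DR) (hv : VT R κ Γ g Dg)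
    {x : EuclideanSpace ℝ (Fin n)} (hx : x ∈ ball 0 (2 * R)) : Uf c g Rt u (io x) = u x := by
  unfold Uf
  rw [V0_bottom h hx, hv.diag x hx, io_apply, pt_emb, mul_zero, th_zero, one_smul]
  rfl

lemma Uf_bound (hR : 0 < R) (h : HT R κ Γ Rt DR) (hv : VT R κ Γ g Dg)
    (hu : ContinuousOn u (ball 0 (2 * R)))
    {M : ℝ} (hM : KB n M)
    {z : EuclideanSpace ℝ (Fin (n + 1))} (hz : z ∈ openCylinder n R R) :
    ‖Uf c g Rt u z‖ ≤ (if c * pt z ≤ 1 then 1 else 0) *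
      (M * ((pt z)⁻¹) ^ n * ∫ y in closedBall (px z) (pt z / 2), ‖u y‖) := by
  unfold Uf
  split_ifs with hc
  · rw [norm_smul, hv.iso z (cc_sub hR (oc_cc hz)), V0_eq hz, Real.norm_of_nonneg (th_nonneg _)]
    gcongr
    · exact th_le_one _
    · exact Vf_bound hR h hu hM hz
  · rw [(th_out (not_le.mp hc)).1]; simp

lemma DUf_bound (hR : 0 < R) (h : HT R κ Γ Rt DR) (hv : VT R κ Γ g Dg)
    (hu : ContinuousOn u (ball 0 (2 * R))) (hκ : 0 ≤ κ) (hc0 : 0 < c) (hκc : κ ≤ c ^ 2)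
    {M Mt : ℝ} (hM0 : 0 < M) (hM : KB n M) (hMt0 : 0 ≤ Mt) (hMt : ∀ r, |deriv th r| ≤ Mt)
    {z : EuclideanSpace ℝ (Fin (n + 1))} (hz : z ∈ openCylinder n R R)
    (v : EuclideanSpace ℝ (Fin (n + 1))) :
    ‖(DUf R c g Dg Rt DR u z + (Γ z).flip (Uf c g Rt u z)) v‖ ≤
      M * (Mt + 2) * (((pt z)⁻¹) ^ (n + 1) *
          (∫ y in closedBall (px z) (pt z / 2), ‖u (px z) - Rt (px z) y (u y)‖)
        + (if c * pt z ≤ 1 then c else 0) *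
          (((pt z)⁻¹) ^ n * ∫ y in closedBall (px z) (pt z / 2), ‖u y‖)) * ‖v‖ := by
  have ht := (mem_openCylinder.mp hz).2.1
  set t := pt z with htd
  set I1 := ∫ y in closedBall (px z) (t / 2), ‖u (px z) - Rt (px z) y (u y)‖ with hI1
  set I2 := ∫ y in closedBall (px z) (t / 2), ‖u y‖ with hI2
  have hI1n : 0 ≤ I1 := integral_nonneg (fun _ => norm_nonneg _)
  have hI2n : 0 ≤ I2 := integral_nonneg (fun _ => norm_nonneg _)
  set V := V0 Rt u z with hV
  set W := DVf R Rt DR u z v with hW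
  set T := Γ (io (px z)) (io (px v)) with hT
  have e1 : (DUf R c g Dg Rt DR u z + (Γ z).flip (Uf c g Rt u z)) v
      = th (c * t) • ((Dg z v + Γ z v * g z - g z * T) V + g z (W + T V))
        + (deriv th (c * t) * (c * pt v)) • g z V := by
    have : (DUf R c g Dg Rt DR u z + (Γ z).flip (Uf c g Rt u z)) v
      = th (c * t) • (g z W + Dg z v V) + (deriv th (c * t) * (c * pt v)) • g z V
        + Γ z v (th (c * t) • g z V) := rfl
    rw [this, map_smul, map_add, sub_apply, add_apply]
    have e2 : (Γ z v * g z) V = Γ z v (g z V) := rfl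
    have e3 : (g z * T) V = g z (T V) := rfl
    rw [e2, e3]
    module
  rw [e1]
  split_ifs with hc
  · have b1 : ‖(Dg z v + Γ z v * g z - g z * T) V‖ ≤ κ * ‖v‖ * t * ‖V‖ :=
      (ContinuousLinearMap.le_opNorm _ _).trans (by
        gcongr; exact hv.bd z (oc_sub hR hz) v)
    have hVb : ‖V‖ ≤ M * (t⁻¹) ^ n * I2 := by
      rw [hV, V0_eq hz]; exact Vf_bound hR h hu hM hz
    have b2 : ‖g z (W + T V)‖ ≤ ‖v‖ * (M * (t⁻¹) ^ (n + 1) * I1 + M * (t⁻¹) ^ n * (κ * t) * I2) := by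
      rw [hv.iso z (cc_sub hR (oc_cc hz)), hV, V0_eq hz]
      exact DVf_bound hR h hu hκ hM hz v
    have b3 : ‖g z V‖ = ‖V‖ := hv.iso z (cc_sub hR (oc_cc hz)) _
    have b4 : |pt v| ≤ ‖v‖ := abs_pt_le v
    have hκt : κ * t ≤ c := by
      calc κ * t ≤ c ^ 2 * t := by gcongr
        _ = c * (c * t) := by ring
        _ ≤ c * 1 := by gcongr
        _ = c := mul_one c
    set Q := (t⁻¹) ^ n * I2 with hQ
    set Q1 := (t⁻¹) ^ (n+1) * I1 with hQ1
    have hQn : 0 ≤ Q := by positivity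
    have hQ1n : 0 ≤ Q1 := by positivity
    calc _ ≤ 1 * (κ * ‖v‖ * t * ‖V‖ + ‖v‖ * (M * (t⁻¹) ^ (n + 1) * I1 + M * (t⁻¹) ^ n * (κ * t) * I2))
          + (Mt * (c * ‖v‖)) * ‖V‖ := by
          refine (norm_add_le _ _).trans ?_
          rw [norm_smul, norm_smul, b3, norm_mul, norm_mul, Real.norm_of_nonneg (th_nonneg _),
            Real.norm_of_nonneg hc0.le]
          gcongr
          · exact th_le_one _
          · exact (norm_add_le _ _).trans (add_le_add b1 b2)
          · exact hMt _
          · exact b4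
      _ ≤ 1 * (c * ‖v‖ * (M * Q) + ‖v‖ * (M * Q1 + M * c * Q))
          + (Mt * (c * ‖v‖)) * (M * Q) := by
          have hVb' : ‖V‖ ≤ M * Q := by rw [hQ, ← mul_assoc]; exact hVb
          have x1 : κ * ‖v‖ * t * ‖V‖ ≤ c * ‖v‖ * (M * Q) := by
            calc _ = (κ * t) * ‖v‖ * ‖V‖ := by ring
              _ ≤ _ := by gcongr
          have x2 : M * (t⁻¹) ^ n * (κ * t) * I2 ≤ M * c * Q := by
            calc _ = M * (κ * t) * Q := by rw [hQ]; ring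
              _ ≤ _ := by gcongr
          have x3 : M * (t⁻¹) ^ (n + 1) * I1 = M * Q1 := by rw [hQ1]; ring
          rw [x3]
          gcongr
      _ = M * (1 * Q1 + (Mt + 2) * (c * Q)) * ‖v‖ := by ring
      _ ≤ M * ((Mt + 2) * Q1 + (Mt + 2) * (c * Q)) * ‖v‖ := by
          gcongr; linarith
      _ = _ := by ring
  · rw [(th_out (not_le.mp hc)).1, (th_out (not_le.mp hc)).2]
    simp only [zero_smul, zero_mul, add_zero, norm_zero]
    positivity

end Extension

section Estimates

/-- Volume of the unit ball. -/
noncomputable def om (n : ℕ) : ℝ := (volume (ball (0 : EuclideanSpace ℝ (Fin n)) 1)).toReal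

lemma om_nonneg (n : ℕ) : 0 ≤ om n := ENNReal.toReal_nonneg

lemma vol_le {n : ℕ} (x : EuclideanSpace ℝ (Fin n)) {t : ℝ} (ht : 0 < t) :
    volume (closedBall x (t/2)) ≤ ENNReal.ofReal (t ^ n) * ENNReal.ofReal (om n) := by
  rw [Measure.addHaar_closedBall _ _ (by positivity), finrank_euclideanSpace_fin, om,
    ENNReal.ofReal_toReal measure_ball_lt_top.ne]
  gcongr
  linarith

lemma jensen_aux {α : Type*} [MeasurableSpace α] (μ : Measure α) {p : ℝ} (hp : 1 ≤ p)
    (g : α → ℝ≥0∞) (hg : AEMeasurable g μ) :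
    (∫⁻ a, g a ∂μ) ^ p ≤ (∫⁻ a, g a ^ p ∂μ) * μ univ ^ (p - 1) := by
  have h := eLpNorm'_le_eLpNorm'_mul_rpow_measure_univ (μ := μ) (f := g) (p := 1) (q := p)
    one_pos hp hg.aestronglyMeasurable
  simp only [eLpNorm', enorm_eq_self, ENNReal.rpow_one, div_one] at h
  have h2 := ENNReal.rpow_le_rpow h (z := p) (by linarith)
  rw [ENNReal.mul_rpow_of_nonneg _ _ (by linarith), ← ENNReal.rpow_mul, ← ENNReal.rpow_mul] at h2
  have e1 : 1 / p * p = 1 := by field_simp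
  have e2 : (1 - 1 / p) * p = p - 1 := by field_simp
  rwa [e1, e2, ENNReal.rpow_one] at h2

lemma jensen {n : ℕ} {p : ℝ} (hp : 1 ≤ p) (x : EuclideanSpace ℝ (Fin n)) {t : ℝ} (ht : 0 < t)
    {f : EuclideanSpace ℝ (Fin n) → ℝ} (hf : ContinuousOn f (closedBall x (t/2)))
    (hf0 : ∀ y, 0 ≤ f y) :
    ENNReal.ofReal (((t⁻¹) ^ n * ∫ y in closedBall x (t/2), f y) ^ p) ≤
      ENNReal.ofReal (om n ^ (p - 1)) * ENNReal.ofReal ((t⁻¹) ^ n) *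
        ∫⁻ y in closedBall x (t/2), ENNReal.ofReal (f y ^ p) := by
  have hint : IntegrableOn f (closedBall x (t/2)) :=
    hf.integrableOn_compact (isCompact_closedBall _ _)
  have hp0 : 0 ≤ p := by linarith
  have h1 := jensen_aux (volume.restrict (closedBall x (t/2))) hp (fun y => ENNReal.ofReal (f y))
    hint.aemeasurable.ennreal_ofReal
  rw [Measure.restrict_apply_univ] at h1
  have hI : 0 ≤ ∫ y in closedBall x (t/2), f y := integral_nonneg fun y => hf0 y
  rw [Real.mul_rpow (by positivity) hI, ENNReal.ofReal_mul (by positivity),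
    ← ENNReal.ofReal_rpow_of_nonneg hI hp0,
    ofReal_integral_eq_lintegral_ofReal hint (Filter.Eventually.of_forall hf0)]
  have h2 : volume (closedBall x (t/2)) ^ (p - 1) ≤
      ENNReal.ofReal ((t ^ n) ^ (p - 1)) * ENNReal.ofReal (om n ^ (p - 1)) := by
    refine (ENNReal.rpow_le_rpow (vol_le x ht) (by linarith)).trans ?_
    rw [ENNReal.mul_rpow_of_nonneg _ _ (by linarith),
      ENNReal.ofReal_rpow_of_nonneg (by positivity) (by linarith),
      ENNReal.ofReal_rpow_of_nonneg (om_nonneg n) (by linarith)]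
  have h3 : ENNReal.ofReal (((t⁻¹) ^ n) ^ p) * ENNReal.ofReal ((t ^ n) ^ (p - 1)) =
      ENNReal.ofReal ((t⁻¹) ^ n) := by
    rw [← ENNReal.ofReal_mul (by positivity)]
    congr 1
    have ha : 0 < t ^ n := by positivity
    rw [inv_pow, Real.inv_rpow ha.le, Real.rpow_sub_one ha.ne']
    have := (Real.rpow_pos_of_pos ha p).ne'
    field_simp
  have h4 : ∫⁻ y in closedBall x (t/2), ENNReal.ofReal (f y) ^ p =
      ∫⁻ y in closedBall x (t/2), ENNReal.ofReal (f y ^ p) := by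
    congr 1; ext y; rw [ENNReal.ofReal_rpow_of_nonneg (hf0 y) hp0]
  rw [h4] at h1
  calc _ ≤ ENNReal.ofReal (((t⁻¹) ^ n) ^ p) * ((∫⁻ y in closedBall x (t/2), ENNReal.ofReal (f y ^ p))
          * (ENNReal.ofReal ((t ^ n) ^ (p - 1)) * ENNReal.ofReal (om n ^ (p - 1)))) := by
        gcongr
        exact h1.trans (by gcongr)
    _ = ENNReal.ofReal (om n ^ (p - 1)) *
        (ENNReal.ofReal (((t⁻¹) ^ n) ^ p) * ENNReal.ofReal ((t ^ n) ^ (p - 1))) *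
        ∫⁻ y in closedBall x (t/2), ENNReal.ofReal (f y ^ p) := by ring
    _ = _ := by rw [h3]

/-- The characteristic function of the relation `|y - x| ≤ t/2`. -/
noncomputable def chi {n : ℕ} (x : EuclideanSpace ℝ (Fin n)) (t : ℝ)
    (y : EuclideanSpace ℝ (Fin n)) : ℝ≥0∞ :=
  {q : (EuclideanSpace ℝ (Fin n) × ℝ) × EuclideanSpace ℝ (Fin n) |
    dist q.2 q.1.1 ≤ q.1.2 / 2}.indicator 1 ((x, t), y)

lemma chi_meas {n : ℕ} : Measurable
    (fun q : (EuclideanSpace ℝ (Fin n) × ℝ) × EuclideanSpace ℝ (Fin n) => chi q.1.1 q.1.2 q.2) := by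
  refine Measurable.indicator measurable_one (measurableSet_le ?_ ?_)
  · exact measurable_snd.dist (measurable_fst.comp measurable_fst)
  · exact (measurable_snd.comp measurable_fst).div_const 2

lemma chi_comp {n : ℕ} {α : Type*} [MeasurableSpace α] {X Y : α → EuclideanSpace ℝ (Fin n)}
    {T : α → ℝ} (hX : Measurable X) (hT : Measurable T) (hY : Measurable Y) :
    Measurable (fun a => chi (X a) (T a) (Y a)) :=
  chi_meas.comp (f := fun a => ((X a, T a), Y a)) ((hX.prodMk hT).prodMk hY)

lemma chi_of_le {n : ℕ} {x y : EuclideanSpace ℝ (Fin n)} {t : ℝ} (h : dist y x ≤ t/2) :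
    chi x t y = 1 := by
  simp [chi, h]

lemma chi_of_not {n : ℕ} {x y : EuclideanSpace ℝ (Fin n)} {t : ℝ} (h : ¬ dist y x ≤ t/2) :
    chi x t y = 0 := by
  simp only [chi]
  exact Set.indicator_of_notMem (by simpa using h) _

lemma chi_symm {n : ℕ} (x y : EuclideanSpace ℝ (Fin n)) (t : ℝ) : chi x t y = chi y t x := by
  by_cases h : dist y x ≤ t/2
  · rw [chi_of_le h, chi_of_le (by rwa [dist_comm])]
  · rw [chi_of_not h, chi_of_not (by rwa [dist_comm])]

lemma lint_chi {n : ℕ} (x : EuclideanSpace ℝ (Fin n)) (t : ℝ)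
    (G : EuclideanSpace ℝ (Fin n) → ℝ≥0∞) :
    ∫⁻ y in closedBall x (t/2), G y = ∫⁻ y, chi x t y * G y := by
  rw [← lintegral_indicator measurableSet_closedBall]
  congr 1; ext y
  by_cases h : dist y x ≤ t/2
  · rw [chi_of_le h, Set.indicator_of_mem (by simpa using h), one_mul]
  · rw [chi_of_not h, Set.indicator_of_notMem (by simpa using h), zero_mul]

lemma lint_chi_one {n : ℕ} (x : EuclideanSpace ℝ (Fin n)) (t : ℝ) :
    ∫⁻ y, chi x t y = volume (closedBall x (t/2)) := by
  have := lint_chi x t 1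
  simpa using this.symm

lemma lemA {n : ℕ} {a : ℝ} (ha : 0 < a) (x : EuclideanSpace ℝ (Fin n))
    {G : EuclideanSpace ℝ (Fin n) → ℝ≥0∞} (hG : Measurable G) (hGx : G x = 0) (R : ℝ) :
    ∫⁻ t in Ioo 0 R, ENNReal.ofReal (t ^ (-1 - a)) * ∫⁻ y in closedBall x (t/2), G y ≤
      ENNReal.ofReal (1 / a) * ∫⁻ y, G y * ENNReal.ofReal (‖x - y‖ ^ (-a)) := by
  have hm0 : Measurable (fun q : ℝ × EuclideanSpace ℝ (Fin n) => chi x q.1 q.2) :=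
    chi_comp measurable_const measurable_fst measurable_snd
  have hmw : Measurable (fun t : ℝ => ENNReal.ofReal (t ^ (-1 - a))) := by fun_prop
  have e1 : ∀ t : ℝ, ENNReal.ofReal (t ^ (-1 - a)) * ∫⁻ y in closedBall x (t/2), G y =
      ∫⁻ y, ENNReal.ofReal (t ^ (-1 - a)) * (chi x t y * G y) := by
    intro t
    rw [lint_chi, lintegral_const_mul]
    exact (chi_comp measurable_const measurable_const measurable_id).mul hG
  simp_rw [e1]
  rw [lintegral_lintegral_swap, ← lintegral_const_mul' _ _ ENNReal.ofReal_ne_top]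
  · refine lintegral_mono fun y => ?_
    by_cases hy : y = x
    · subst hy; simp [hGx]
    have hr : 0 < ‖x - y‖ := norm_pos_iff.2 (sub_ne_zero.2 (Ne.symm hy))
    have e2 : ∀ t : ℝ, ENNReal.ofReal (t ^ (-1 - a)) * (chi x t y * G y) =
        G y * (ENNReal.ofReal (t ^ (-1 - a)) * chi x t y) := fun t => by ring
    simp_rw [e2]
    rw [lintegral_const_mul]
    swap
    · exact hmw.mul (chi_comp measurable_const measurable_id measurable_const)
    have h3 : ∫⁻ t in Ioo 0 R, ENNReal.ofReal (t ^ (-1 - a)) * chi x t y ≤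
        ∫⁻ t in Ioi ‖x - y‖, ENNReal.ofReal (t ^ (-1 - a)) := by
      rw [← lintegral_indicator measurableSet_Ioo, ← lintegral_indicator measurableSet_Ioi]
      refine lintegral_mono fun t => ?_
      by_cases ht : t ∈ Ioo 0 R
      · rw [Set.indicator_of_mem ht]
        by_cases h : dist y x ≤ t/2
        · rw [Set.indicator_of_mem, chi_of_le h, mul_one]
          rw [dist_comm, dist_eq_norm] at h
          simp only [mem_Ioi]; linarith
        · rw [chi_of_not h]; simp
      · rw [Set.indicator_of_notMem ht]; exact zero_le
    have h4 : ∫⁻ t in Ioi ‖x - y‖, ENNReal.ofReal (t ^ (-1 - a)) =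
        ENNReal.ofReal (1 / a) * ENNReal.ofReal (‖x - y‖ ^ (-a)) := by
      rw [← ofReal_integral_eq_lintegral_ofReal (integrableOn_Ioi_rpow_of_lt (by linarith) hr)]
      · rw [integral_Ioi_rpow_of_lt (by linarith) hr, ← ENNReal.ofReal_mul (by positivity)]
        congr 1
        have : -1 - a + 1 = -a := by ring
        rw [this]; field_simp
      · refine (ae_restrict_iff' measurableSet_Ioi).2 (Filter.Eventually.of_forall fun t ht => ?_)
        exact Real.rpow_nonneg (hr.le.trans (mem_Ioi.1 ht).le) _
    calc _ ≤ G y * (ENNReal.ofReal (1 / a) * ENNReal.ofReal (‖x - y‖ ^ (-a))) := by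
          rw [← h4]; gcongr
      _ = _ := by ring
  · refine Measurable.aemeasurable ?_
    exact (hmw.comp measurable_fst).mul (hm0.mul (hG.comp measurable_snd))

lemma wint {b c : ℝ} (hb : 0 < b) (hc : 0 < c) (R : ℝ) :
    ∫⁻ t in Ioo 0 R, (if c * t ≤ 1 then 1 else 0) * ENNReal.ofReal (t ^ (b - 1)) ≤
      ENNReal.ofReal (c ^ (-b) / b) := by
  have hc' : 0 ≤ 1 / c := by positivity
  have h1 : ∫⁻ t in Ioo 0 R, (if c * t ≤ 1 then 1 else 0) * ENNReal.ofReal (t ^ (b - 1)) ≤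
      ∫⁻ t in Ioc 0 (1/c), ENNReal.ofReal (t ^ (b - 1)) := by
    rw [← lintegral_indicator measurableSet_Ioo, ← lintegral_indicator measurableSet_Ioc]
    refine lintegral_mono fun t => ?_
    by_cases ht : t ∈ Ioo 0 R
    · rw [Set.indicator_of_mem ht]
      by_cases h : c * t ≤ 1
      · rw [Set.indicator_of_mem, if_pos h, one_mul]
        refine ⟨ht.1, ?_⟩
        rw [le_div_iff₀ hc]; linarith
      · rw [if_neg h]; simp
    · rw [Set.indicator_of_notMem ht]; exact zero_le
  refine h1.trans ?_
  have hi := intervalIntegral.intervalIntegrable_rpow' (a := 0) (b := 1/c) (r := b - 1) (by linarith)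
  rw [intervalIntegrable_iff_integrableOn_Ioc_of_le hc'] at hi
  rw [← ofReal_integral_eq_lintegral_ofReal hi]
  · rw [← intervalIntegral.integral_of_le hc', integral_rpow (Or.inl (by linarith))]
    apply le_of_eq
    congr 1
    rw [sub_add_cancel, Real.zero_rpow hb.ne', sub_zero, one_div, Real.inv_rpow hc.le,
      Real.rpow_neg hc.le]
  · refine (ae_restrict_iff' measurableSet_Ioc).2 (Filter.Eventually.of_forall fun t ht => ?_)
    exact Real.rpow_nonneg ht.1.le _

/-- The weight in the second estimate. -/
noncomputable def wt (n : ℕ) (b c t : ℝ) : ℝ≥0∞ :=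
  (if c * t ≤ 1 then 1 else 0) * ENNReal.ofReal (t ^ (b - 1 - n))

lemma wt_meas (n : ℕ) (b c : ℝ) : Measurable (wt n b c) := by
  unfold wt
  refine Measurable.mul (Measurable.ite ?_ measurable_const measurable_const) (by fun_prop)
  exact measurableSet_le (by fun_prop) measurable_const

lemma lint_meas {n : ℕ} {G : EuclideanSpace ℝ (Fin n) → ℝ≥0∞} (hG : Measurable G) :
    Measurable (fun q : EuclideanSpace ℝ (Fin n) × ℝ => ∫⁻ y in closedBall q.1 (q.2/2), G y) := by
  simp_rw [lint_chi]
  have h : Measurable (fun q : (EuclideanSpace ℝ (Fin n) × ℝ) × EuclideanSpace ℝ (Fin n) =>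
      chi q.1.1 q.1.2 q.2 * G q.2) := chi_meas.mul (hG.comp measurable_snd)
  exact h.lintegral_prod_right'

lemma wl_meas {n : ℕ} (b c : ℝ) {G : EuclideanSpace ℝ (Fin n) → ℝ≥0∞} (hG : Measurable G) :
    Measurable (fun q : EuclideanSpace ℝ (Fin n) × ℝ =>
      wt n b c q.2 * ∫⁻ y in closedBall q.1 (q.2/2), G y) := by
  have h : Measurable (fun q : EuclideanSpace ℝ (Fin n) × ℝ => wt n b c q.2) :=
    (wt_meas n b c).comp measurable_snd
  exact h.mul (lint_meas hG)

lemma lemB {n : ℕ} {b c : ℝ} (hb : 0 < b) (hc : 0 < c)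
    {G : EuclideanSpace ℝ (Fin n) → ℝ≥0∞} (hG : Measurable G) (R : ℝ) 
    (S : Set (EuclideanSpace ℝ (Fin n))) :
    ∫⁻ x in S, ∫⁻ t in Ioo 0 R, wt n b c t * ∫⁻ y in closedBall x (t/2), G y ≤
      ENNReal.ofReal (om n) * ENNReal.ofReal (c ^ (-b) / b) * ∫⁻ y, G y := by
  refine (setLIntegral_le_lintegral _ _).trans ?_
  rw [lintegral_lintegral_swap (wl_meas b c hG).aemeasurable]
  have h1 : ∀ t ∈ Ioo 0 R, ∫⁻ x, wt n b c t * ∫⁻ y in closedBall x (t/2), G y ≤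
      ((if c * t ≤ 1 then 1 else 0) * ENNReal.ofReal (t ^ (b - 1))) *
        (ENNReal.ofReal (om n) * ∫⁻ y, G y) := by
    intro t ht
    have hm : Measurable (fun q : EuclideanSpace ℝ (Fin n) × EuclideanSpace ℝ (Fin n) =>
        chi q.1 t q.2) :=
      chi_comp measurable_fst measurable_const measurable_snd
    have hm2 : Measurable (fun x : EuclideanSpace ℝ (Fin n) => ∫⁻ y in closedBall x (t/2), G y) :=
      (lint_meas hG).comp (g := fun q : EuclideanSpace ℝ (Fin n) × ℝ => ∫⁻ y in closedBall q.1 (q.2/2), G y)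
        (f := fun x => (x, t)) (measurable_id.prodMk measurable_const)
    rw [lintegral_const_mul _ hm2]
    simp_rw [lint_chi]
    rw [lintegral_lintegral_swap (hm.mul (hG.comp measurable_snd)).aemeasurable]
    have h2 : ∀ y, ∫⁻ x, chi x t y * G y ≤
        (ENNReal.ofReal (t ^ n) * ENNReal.ofReal (om n)) * G y := by
      intro y
      rw [lintegral_mul_const (f := fun x => chi x t y) _ (chi_comp measurable_id measurable_const measurable_const)]
      simp_rw [fun x => chi_symm x y t]
      rw [lint_chi_one]
      gcongr
      exact vol_le y ht.1
    calc _ ≤ wt n b c t * ∫⁻ y, (ENNReal.ofReal (t ^ n) * ENNReal.ofReal (om n)) * G y := by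
          gcongr with y; exact h2 y
      _ = (if c * t ≤ 1 then 1 else 0) * (ENNReal.ofReal (t ^ (b - 1 - n)) * ENNReal.ofReal (t ^ n)) *
          (ENNReal.ofReal (om n) * ∫⁻ y, G y) := by
          rw [lintegral_const_mul _ hG, wt]; ring
      _ = _ := by
          rw [← ENNReal.ofReal_mul (Real.rpow_nonneg ht.1.le _), ← Real.rpow_natCast t n,
            ← Real.rpow_add ht.1, sub_add_cancel]
  refine (setLIntegral_mono' measurableSet_Ioo h1).trans ?_
  rw [lintegral_mul_const]
  · calc _ ≤ ENNReal.ofReal (c ^ (-b) / b) * (ENNReal.ofReal (om n) * ∫⁻ y, G y) := by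
          gcongr; exact wint hb hc R
      _ = _ := by ring
  · refine Measurable.mul (Measurable.ite ?_ measurable_const measurable_const) (by fun_prop)
    exact measurableSet_le (by fun_prop) measurable_const

lemma ind_meas {α : Type*} [TopologicalSpace α] [MeasurableSpace α] [BorelSpace α] {S : Set α}
    (hS : MeasurableSet S) {f : α → ℝ} (hf : ContinuousOn f S) :
    Measurable (S.indicator fun y => ENNReal.ofReal (f y)) := by
  classical
  have h : ContinuousOn (fun y => ENNReal.ofReal (f y)) S :=
    ENNReal.continuous_ofReal.comp_continuousOn hf
  have := h.measurable_piecewise (g := fun _ => 0) continuousOn_const hS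
  exact Set.piecewise_eq_indicator (f := fun y => ENNReal.ofReal (f y)) (s := S) ▸ this

end Estimates

section Estimates2

lemma sub_two {n : ℕ} {R t : ℝ} {x : EuclideanSpace ℝ (Fin n)} (hx : x ∈ ball 0 R)
    (ht : t ∈ Ioo 0 R) : closedBall x (t/2) ⊆ ball 0 (2 * R) := by
  intro y hy
  rw [mem_closedBall] at hy
  rw [mem_ball] at hx ⊢
  have := dist_triangle y x 0
  have := ht.1
  have := ht.2
  linarith

lemma add_rpow_le_two {p A B : ℝ} (hp : 1 ≤ p) (hA : 0 ≤ A) (hB : 0 ≤ B) :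
    (A + B) ^ p ≤ 2 ^ p * (A ^ p + B ^ p) := by
  have hp0 : 0 ≤ p := by linarith
  have h : A + B ≤ 2 * max A B := by
    have := le_max_left A B; have := le_max_right A B; linarith
  have hm : 0 ≤ max A B := hA.trans (le_max_left _ _)
  refine (Real.rpow_le_rpow (by positivity) h hp0).trans ?_
  rw [Real.mul_rpow (by norm_num) hm]
  gcongr
  have := Real.rpow_nonneg hA p
  have := Real.rpow_nonneg hB p
  rcases max_choice A B with h | h <;> rw [h] <;> linarith

lemma pw {n : ℕ} {p e R : ℝ} (hp : 1 ≤ p) {x : EuclideanSpace ℝ (Fin n)} {t : ℝ}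
    (hx : x ∈ ball 0 R) (ht : t ∈ Ioo 0 R)
    {f : EuclideanSpace ℝ (Fin n) → ℝ} (hf : ContinuousOn f (ball 0 (2 * R)))
    (hf0 : ∀ y, 0 ≤ f y) :
    ENNReal.ofReal (t ^ e * ((t⁻¹) ^ n * ∫ y in closedBall x (t/2), f y) ^ p) ≤
      ENNReal.ofReal (om n ^ (p - 1)) * (ENNReal.ofReal (t ^ (e - n)) *
        ∫⁻ y in closedBall x (t/2), (ball 0 (2 * R)).indicator
          (fun y => ENNReal.ofReal (f y ^ p)) y) := by
  have ht0 := ht.1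
  have h1 := jensen hp x ht0 (hf.mono (sub_two hx ht)) hf0
  have h2 : ∫⁻ y in closedBall x (t/2), (ball 0 (2 * R)).indicator
      (fun y => ENNReal.ofReal (f y ^ p)) y =
      ∫⁻ y in closedBall x (t/2), ENNReal.ofReal (f y ^ p) :=
    setLIntegral_congr_fun measurableSet_closedBall fun y hy =>
      Set.indicator_of_mem (sub_two hx ht hy) _
  rw [h2, ENNReal.ofReal_mul (by positivity)]
  have h3 : ENNReal.ofReal (t ^ (e - n)) = ENNReal.ofReal (t ^ e) * ENNReal.ofReal ((t⁻¹) ^ n) := by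
    rw [← ENNReal.ofReal_mul (by positivity), Real.rpow_sub ht0, Real.rpow_natCast, inv_pow]; rfl
  rw [h3]
  refine (mul_le_mul_right h1 _).trans (le_of_eq ?_)
  ring

lemma est2 {n : ℕ} {p b c M R : ℝ} (hp : 1 ≤ p) (hb : 0 < b) (hc : 0 < c) (hM : 0 ≤ M)
    {f : EuclideanSpace ℝ (Fin n) → ℝ} (hf : ContinuousOn f (ball 0 (2 * R)))
    (hf0 : ∀ y, 0 ≤ f y) {H : EuclideanSpace ℝ (Fin n) → ℝ → ℝ}
    (hH0 : ∀ x t, 0 ≤ H x t)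
    (hH : ∀ x ∈ ball 0 R, ∀ t ∈ Ioo 0 R, H x t ≤ (if c * t ≤ 1 then 1 else 0) *
      (M * (t⁻¹) ^ n * ∫ y in closedBall x (t/2), f y)) :
    ∫⁻ x in ball 0 R, ∫⁻ t in Ioo 0 R, ENNReal.ofReal (H x t ^ p / t ^ (1 - b)) ≤
      ENNReal.ofReal (M ^ p * om n ^ (p - 1)) * (ENNReal.ofReal (om n) *
        ENNReal.ofReal (c ^ (-b) / b) * ∫⁻ y in ball 0 (2 * R), ENNReal.ofReal (f y ^ p)) := by
  have hp0 : 0 ≤ p := by linarith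
  have hW : 0 ≤ om n ^ (p - 1) := Real.rpow_nonneg (om_nonneg n) _
  set G : EuclideanSpace ℝ (Fin n) → ℝ≥0∞ :=
    (ball 0 (2 * R)).indicator (fun y => ENNReal.ofReal (f y ^ p)) with hGd
  have hG : Measurable G := ind_meas measurableSet_ball
    (hf.rpow_const fun _ _ => Or.inr hp0)
  rw [← lintegral_indicator measurableSet_ball (fun y => ENNReal.ofReal (f y ^ p)), ← hGd]
  refine le_trans ?_ (mul_le_mul_right (lemB hb hc hG R (ball 0 R)) _)
  rw [← lintegral_const_mul' _ _ ENNReal.ofReal_ne_top]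
  refine setLIntegral_mono' measurableSet_ball fun x hx => ?_
  rw [← lintegral_const_mul' _ _ ENNReal.ofReal_ne_top]
  refine setLIntegral_mono' measurableSet_Ioo fun t ht => ?_
  have ht0 := ht.1
  have h1 := hH x hx t ht
  have hI : 0 ≤ ∫ y in closedBall x (t/2), f y := integral_nonneg fun y => hf0 y
  by_cases h : c * t ≤ 1
  · rw [if_pos h, one_mul] at h1
    have h2 := pw (e := b - 1) hp hx ht hf hf0
    rw [wt, if_pos h, one_mul, ENNReal.ofReal_mul (by positivity), mul_assoc]
    refine le_trans ?_ (mul_le_mul_right h2 _)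
    rw [← ENNReal.ofReal_mul (by positivity)]
    apply ENNReal.ofReal_le_ofReal
    have h3 : H x t ^ p ≤ M ^ p * ((t⁻¹) ^ n * ∫ y in closedBall x (t/2), f y) ^ p := by
      rw [← Real.mul_rpow hM (by positivity)]
      exact Real.rpow_le_rpow (hH0 _ _) (by rwa [← mul_assoc]) hp0
    have h4 : H x t ^ p / t ^ (1 - b) = t ^ (b - 1) * H x t ^ p := by
      rw [show b - 1 = -(1 - b) by ring, Real.rpow_neg ht0.le]; field_simp
    rw [h4]
    calc _ ≤ t ^ (b - 1) * (M ^ p * ((t⁻¹) ^ n * ∫ y in closedBall x (t/2), f y) ^ p) := by gcongr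
      _ = _ := by ring
  · rw [if_neg h, zero_mul] at h1
    have h2 : H x t = 0 := le_antisymm h1 (hH0 x t)
    rw [h2, Real.zero_rpow (by linarith)]; simp

lemma est1 {n : ℕ} {p s b c K R a : ℝ} (hp : 1 ≤ p) (hs : 0 < s) (hbd : b = (1 - s) * p)
    (had : a = n + s * p) (hb : 0 < b)
    (hc : 0 < c) (hK : 0 ≤ K)
    {f : EuclideanSpace ℝ (Fin n) → ℝ} (hf : ContinuousOn f (ball 0 (2 * R)))
    (hf0 : ∀ y, 0 ≤ f y) 
    {k : EuclideanSpace ℝ (Fin n) → EuclideanSpace ℝ (Fin n) → ℝ}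
    (hk : ∀ x ∈ ball 0 R, ContinuousOn (k x) (ball 0 (2 * R)))
    (hk0 : ∀ x y, 0 ≤ k x y) (hkd : ∀ x ∈ ball 0 R, k x x = 0)
    {H : EuclideanSpace ℝ (Fin n) → ℝ → ℝ}
    (hH0 : ∀ x t, 0 ≤ H x t)
    (hH : ∀ x ∈ ball 0 R, ∀ t ∈ Ioo 0 R, H x t ≤ K * ((t⁻¹) ^ (n + 1) *
      (∫ y in closedBall x (t/2), k x y) + (if c * t ≤ 1 then c else 0) *
      ((t⁻¹) ^ n * ∫ y in closedBall x (t/2), f y))) :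
    ∫⁻ x in ball 0 R, ∫⁻ t in Ioo 0 R, ENNReal.ofReal (H x t ^ p / t ^ (1 - b)) ≤
      ENNReal.ofReal (K ^ p * 2 ^ p * om n ^ (p - 1)) * (ENNReal.ofReal (1 / a) *
        (∫⁻ x in ball 0 (2 * R), ∫⁻ y in ball 0 (2 * R), ENNReal.ofReal (k x y ^ p / ‖x - y‖ ^ a)) +
        ENNReal.ofReal (c ^ p) * (ENNReal.ofReal (om n) *
        ENNReal.ofReal (c ^ (-b) / b) * ∫⁻ y in ball 0 (2 * R), ENNReal.ofReal (f y ^ p))) := by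
  have hp0 : 0 ≤ p := by linarith
  have hpp : 0 < p := by linarith
  have ha : 0 < a := by rw [had]; positivity
  have hW : 0 ≤ om n ^ (p - 1) := Real.rpow_nonneg (om_nonneg n) _
  set G : EuclideanSpace ℝ (Fin n) → ℝ≥0∞ :=
    (ball 0 (2 * R)).indicator (fun y => ENNReal.ofReal (f y ^ p)) with hGd
  have hG : Measurable G := ind_meas measurableSet_ball
    (hf.rpow_const fun _ _ => Or.inr hp0)
  rw [← lintegral_indicator measurableSet_ball (fun y => ENNReal.ofReal (f y ^ p)), ← hGd]
  set Q : EuclideanSpace ℝ (Fin n) → EuclideanSpace ℝ (Fin n) → ℝ≥0∞ := fun x =>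
    (ball 0 (2 * R)).indicator (fun y => ENNReal.ofReal (k x y ^ p)) with hQd
  -- the pointwise bound
  have hpt : ∀ x ∈ ball 0 R, ∀ t ∈ Ioo 0 R, ENNReal.ofReal (H x t ^ p / t ^ (1 - b)) ≤
      ENNReal.ofReal (K ^ p * 2 ^ p * om n ^ (p - 1)) *
        (ENNReal.ofReal (t ^ (-1 - a)) * (∫⁻ y in closedBall x (t/2), Q x y) +
          ENNReal.ofReal (c ^ p) * (wt n b c t * ∫⁻ y in closedBall x (t/2), G y)) := by
    intro x hx t ht
    have ht0 := ht.1
    have h1 := hH x hx t ht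
    have hIf : 0 ≤ ∫ y in closedBall x (t/2), f y := integral_nonneg fun y => hf0 y
    have hIk : 0 ≤ ∫ y in closedBall x (t/2), k x y := integral_nonneg fun y => hk0 x y
    set Jf := (t⁻¹) ^ n * ∫ y in closedBall x (t/2), f y with hJf
    set Jk := (t⁻¹) ^ n * ∫ y in closedBall x (t/2), k x y with hJk
    have hJf0 : 0 ≤ Jf := by positivity
    have hJk0 : 0 ≤ Jk := by positivity
    have p1 := pw (e := -1 - s * p) hp hx ht (hk x hx) (hk0 x)
    have p2 := pw (e := b - 1) hp hx ht hf hf0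
    rw [← hJk, show -1 - s * p - n = -1 - a by rw [had]; ring] at p1
    rw [← hJf] at p2
    have e1 : (t⁻¹) ^ (n + 1) * (∫ y in closedBall x (t/2), k x y) = t⁻¹ * Jk := by
      rw [hJk, pow_succ]; ring
    rw [e1] at h1
    set ι : ℝ := if c * t ≤ 1 then 1 else 0 with hι
    have e2 : (if c * t ≤ 1 then c else 0) = ι * c := by rw [hι]; split_ifs <;> simp
    have hι0 : 0 ≤ ι := by rw [hι]; split_ifs <;> norm_num
    have hιp : ι ^ p = ι := by
      rw [hι]; split_ifs
      · simp
      · exact Real.zero_rpow hpp.ne'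
    have e3 : (if c * t ≤ 1 then (1:ℝ≥0∞) else 0) = ENNReal.ofReal ι := by
      rw [hι]; split_ifs <;> simp
    rw [e2] at h1
    have h3 : H x t ^ p ≤ K ^ p * (2 ^ p * ((t⁻¹ * Jk) ^ p + (ι * c * Jf) ^ p)) := by
      refine (Real.rpow_le_rpow (hH0 _ _) h1 hp0).trans ?_
      rw [Real.mul_rpow hK (by positivity)]
      gcongr
      exact add_rpow_le_two hp (by positivity) (by positivity)
    have h4 : H x t ^ p / t ^ (1 - b) = t ^ (b - 1) * H x t ^ p := by
      rw [show b - 1 = -(1 - b) by ring, Real.rpow_neg ht0.le]; field_simp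
    have h5 : t ^ (b - 1) * (t⁻¹ * Jk) ^ p = t ^ (-1 - s * p) * Jk ^ p := by
      rw [Real.mul_rpow (by positivity) hJk0, ← mul_assoc, Real.inv_rpow ht0.le,
        ← Real.rpow_neg ht0.le, ← Real.rpow_add ht0]
      congr 2
      rw [hbd]; ring
    have h6 : (ι * c * Jf) ^ p = ι * c ^ p * Jf ^ p := by
      rw [Real.mul_rpow (by positivity) hJf0, Real.mul_rpow hι0 hc.le, hιp]
    have h7 : H x t ^ p / t ^ (1 - b) ≤ K ^ p * 2 ^ p * (t ^ (-1 - s * p) * Jk ^ p +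
        c ^ p * (ι * (t ^ (b - 1) * Jf ^ p))) := by
      rw [h4]
      calc _ ≤ t ^ (b - 1) * (K ^ p * (2 ^ p * ((t⁻¹ * Jk) ^ p + (ι * c * Jf) ^ p))) := by gcongr
        _ = K ^ p * 2 ^ p * (t ^ (b - 1) * (t⁻¹ * Jk) ^ p + t ^ (b - 1) * (ι * c * Jf) ^ p) := by ring
        _ = _ := by rw [h5, h6]; ring
    refine (ENNReal.ofReal_le_ofReal h7).trans ?_
    rw [ENNReal.ofReal_mul (by positivity), ENNReal.ofReal_add (by positivity) (by positivity),
      ENNReal.ofReal_mul (p := c ^ p) (by positivity), ENNReal.ofReal_mul (p := ι) hι0,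
      ENNReal.ofReal_mul (q := om n ^ (p - 1)) (by positivity), wt, e3, mul_assoc]
    gcongr
    refine (add_le_add p1 (mul_le_mul_right (mul_le_mul_right p2 (ENNReal.ofReal ι))
      (ENNReal.ofReal (c ^ p)))).trans (le_of_eq ?_)
    simp only [hQd, hGd]
    ring
  have hmx : Measurable fun x => ∫⁻ t in Ioo 0 R,
      ENNReal.ofReal (c ^ p) * (wt n b c t * ∫⁻ y in closedBall x (t/2), G y) := by
    have h := (wl_meas b c hG).const_mul (ENNReal.ofReal (c ^ p))
    exact h.lintegral_prod_right'
  have hmt : ∀ x, Measurable fun t =>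
      ENNReal.ofReal (c ^ p) * (wt n b c t * ∫⁻ y in closedBall x (t/2), G y) := by
    intro x
    have h := (wl_meas b c hG).const_mul (ENNReal.ofReal (c ^ p))
    exact h.comp (f := fun t : ℝ => (x, t)) (measurable_const.prodMk measurable_id)
  calc _ ≤ ∫⁻ x in ball 0 R, ENNReal.ofReal (K ^ p * 2 ^ p * om n ^ (p - 1)) *
        (ENNReal.ofReal (1 / a) *
          (∫⁻ y in ball 0 (2 * R), ENNReal.ofReal (k x y ^ p / ‖x - y‖ ^ a)) +
        ∫⁻ t in Ioo 0 R,
          ENNReal.ofReal (c ^ p) * (wt n b c t * ∫⁻ y in closedBall x (t/2), G y)) := by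
        refine setLIntegral_mono' measurableSet_ball fun x hx => ?_
        refine (setLIntegral_mono' measurableSet_Ioo (hpt x hx)).trans ?_
        rw [lintegral_const_mul' _ _ ENNReal.ofReal_ne_top, lintegral_add_right _ (hmt x)]
        gcongr
        have hQm : Measurable (Q x) := ind_meas measurableSet_ball
          ((hk x hx).rpow_const fun _ _ => Or.inr hp0)
        have hQx : Q x x = 0 := by
          have : x ∈ ball (0 : EuclideanSpace ℝ (Fin n)) (2 * R) := by
            rw [mem_ball] at hx ⊢
            have := dist_nonneg (x := x) (y := 0)
            linarith
          simp only [hQd]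
          rw [Set.indicator_of_mem this, hkd x hx, Real.zero_rpow hpp.ne']; simp
        refine (lemA ha x hQm hQx R).trans (mul_le_mul_right ?_ _)
        rw [← lintegral_indicator measurableSet_ball]
        refine lintegral_mono fun y => ?_
        by_cases hy : y ∈ ball (0 : EuclideanSpace ℝ (Fin n)) (2 * R)
        · simp only [hQd]
          rw [Set.indicator_of_mem hy, Set.indicator_of_mem hy,
            ← ENNReal.ofReal_mul (Real.rpow_nonneg (hk0 x y) _), Real.rpow_neg (norm_nonneg _)]
          rfl
        · simp only [hQd]
          rw [Set.indicator_of_notMem hy, zero_mul]; exact zero_le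
    _ ≤ _ := by
        rw [lintegral_const_mul' _ _ ENNReal.ofReal_ne_top, lintegral_add_right _ hmx,
          lintegral_const_mul' _ _ ENNReal.ofReal_ne_top]
        have hR2 : ball (0 : EuclideanSpace ℝ (Fin n)) R ⊆ ball 0 (2 * R) := by
          intro x hx
          rw [mem_ball] at hx ⊢
          have := dist_nonneg (x := x) (y := 0)
          linarith
        refine mul_le_mul_right (add_le_add (mul_le_mul_right ?_ _) ?_) _
        · exact lintegral_mono_set hR2
        · simp_rw [lintegral_const_mul' _ _ (ENNReal.ofReal_ne_top (r := c ^ p))]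
          exact mul_le_mul_right (lemB hb hc hG R (ball 0 R)) _

end Estimates2

/-- Local version of the gauge-covariant extension theorem on a
cylinder, with a constant depending only on `n`, `s`, `p` (not on `R`). -/
theorem extension_weighted_estimates_local
    {F : Type*} [NormedAddCommGroup F] [InnerProductSpace ℝ F] [FiniteDimensional ℝ F]
    (n : ℕ) (hn : 1 ≤ n) (s p : ℝ) (hs0 : 0 < s) (hs1 : s < 1) (hp : 1 ≤ p) :
    ∃ C : ℝ, 0 < C ∧
      ∀ R : ℝ, 0 < R →
      ∀ (Γ : EuclideanSpace ℝ (Fin (n + 1)) →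
          EuclideanSpace ℝ (Fin (n + 1)) →L[ℝ] F →L[ℝ] F)
        (DΓ : EuclideanSpace ℝ (Fin (n + 1)) →
          EuclideanSpace ℝ (Fin (n + 1)) →L[ℝ] EuclideanSpace ℝ (Fin (n + 1)) →L[ℝ] F →L[ℝ] F),
        -- Γ of class C¹ on cl(B_{2R}) × [0,R], with skew-adjoint values
        (∀ z ∈ closedCylinder n (2 * R) R,
          HasFDerivWithinAt Γ (DΓ z) (closedCylinder n (2 * R) R) z) →
        ContinuousOn Γ (closedCylinder n (2 * R) R) →
        ContinuousOn DΓ (closedCylinder n (2 * R) R) →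
        (∀ z ∈ closedCylinder n (2 * R) R, ∀ (v : EuclideanSpace ℝ (Fin (n + 1))) (u w : F),
          ⟪(Γ z v) u, w⟫ = -⟪u, (Γ z v) w⟫) →
        -- β satisfies ‖K_Γ‖_{L∞(B_{2R}×(0,R))} + 1/R² ≤ β
        ∀ β : ℝ,
        (∀ x ∈ ball (0 : EuclideanSpace ℝ (Fin n)) (2 * R), ∀ t ∈ Ioo (0:ℝ) R,
          ∀ v w : EuclideanSpace ℝ (Fin (n + 1)),
          ‖((DΓ (emb x t)) v) w - ((DΓ (emb x t)) w) v
            + ((Γ (emb x t)) v).comp ((Γ (emb x t)) w)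
            - ((Γ (emb x t)) w).comp ((Γ (emb x t)) v)‖
              ≤ (β - 1 / R ^ 2) * ‖v‖ * ‖w‖) →
        -- u is C¹ on cl(B_{2R})
        ∀ u : EuclideanSpace ℝ (Fin n) → F,
        ContDiffOn ℝ 1 u (closedBall (0 : EuclideanSpace ℝ (Fin n)) (2 * R)) →
        -- Rt x y is the parallel transport R^{Γ∥}(x,y) along the boundary segment
        ∀ Rt : EuclideanSpace ℝ (Fin n) → EuclideanSpace ℝ (Fin n) → F →L[ℝ] F,
        (∀ x ∈ ball (0 : EuclideanSpace ℝ (Fin n)) (2 * R),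
         ∀ y ∈ ball (0 : EuclideanSpace ℝ (Fin n)) (2 * R), ∃ P : ℝ → F →L[ℝ] F,
          P 1 = ContinuousLinearMap.id ℝ F ∧
          (∀ t ∈ Icc (0:ℝ) 1, HasDerivWithinAt P
            (-((Γ (emb ((1 - t) • x + t • y) 0)) (emb (y - x) 0)).comp (P t))
            (Icc (0:ℝ) 1) t) ∧
          Rt x y = P 0) →
        -- there is an extension U of u on the cylinder with the two weighted estimates
        ∃ (U : EuclideanSpace ℝ (Fin (n + 1)) → F)
          (DU : EuclideanSpace ℝ (Fin (n + 1)) → EuclideanSpace ℝ (Fin (n + 1)) →L[ℝ] F),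
          (∀ z ∈ openCylinder n R R, HasFDerivAt U (DU z) z) ∧
          ContinuousOn DU (openCylinder n R R) ∧
          ContinuousOn U (closedCylinder n R R) ∧
          (∀ x ∈ ball (0 : EuclideanSpace ℝ (Fin n)) R, U (emb x 0) = u x) ∧
          (∫⁻ x in ball (0 : EuclideanSpace ℝ (Fin n)) R, ∫⁻ t in Ioo (0:ℝ) R,
              ENNReal.ofReal
                (hsNorm (DU (emb x t) + (Γ (emb x t)).flip (U (emb x t))) ^ p
                  / t ^ (1 - (1 - s) * p)))
            ≤ ENNReal.ofReal C *
              ((∫⁻ x in ball (0 : EuclideanSpace ℝ (Fin n)) (2 * R),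
                ∫⁻ y in ball (0 : EuclideanSpace ℝ (Fin n)) (2 * R),
                  ENNReal.ofReal (‖u x - (Rt x y) (u y)‖ ^ p / ‖x - y‖ ^ ((n : ℝ) + s * p)))
                + ENNReal.ofReal (β ^ (s * p / 2)) *
                  ∫⁻ x in ball (0 : EuclideanSpace ℝ (Fin n)) (2 * R),
                    ENNReal.ofReal (‖u x‖ ^ p)) ∧
          (∫⁻ x in ball (0 : EuclideanSpace ℝ (Fin n)) R, ∫⁻ t in Ioo (0:ℝ) R,
              ENNReal.ofReal (‖U (emb x t)‖ ^ p / t ^ (1 - (1 - s) * p)))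
            ≤ ENNReal.ofReal (C / β ^ ((1 - s) * p / 2)) *
              ∫⁻ x in ball (0 : EuclideanSpace ℝ (Fin n)) (2 * R),
                ENNReal.ofReal (‖u x‖ ^ p) := by
  have := FiniteDimensional.complete ℝ F
  obtain ⟨M, hM0, hM⟩ := ker_bound n
  obtain ⟨Mt, hMt0, hMt⟩ := th_bound
  have hp0 : 0 < p := by linarith
  obtain ⟨b, hbd⟩ : ∃ b, b = (1 - s) * p := ⟨_, rfl⟩
  obtain ⟨a, had⟩ : ∃ a : ℝ, a = n + s * p := ⟨_, rfl⟩
  have hb : 0 < b := by rw [hbd]; exact mul_pos (by linarith) hp0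
  have ha : 0 < a := by rw [had]; positivity
  obtain ⟨K, hKd⟩ : ∃ K : ℝ, K = √((n + 1 : ℕ) : ℝ) * (M * (Mt + 2)) := ⟨_, rfl⟩
  have hK0 : 0 ≤ K := by rw [hKd]; positivity
  have hom := om_nonneg n
  obtain ⟨A1, hA1⟩ : ∃ A1 : ℝ, A1 = K ^ p * 2 ^ p * om n ^ (p - 1) := ⟨_, rfl⟩
  obtain ⟨A2, hA2⟩ : ∃ A2 : ℝ, A2 = M ^ p * om n ^ (p - 1) := ⟨_, rfl⟩
  have hA10 : 0 ≤ A1 := by rw [hA1]; positivity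
  have hA20 : 0 ≤ A2 := by rw [hA2]; positivity
  have t1 : 0 ≤ A1 * (1 / a) := by positivity
  have t2 : 0 ≤ A1 * om n / b := by positivity
  have t3 : 0 ≤ A2 * om n / b := by positivity
  obtain ⟨C, hC⟩ : ∃ C, C = 1 + A1 * (1 / a) + A1 * om n / b + A2 * om n / b := ⟨_, rfl⟩
  refine ⟨C, by rw [hC]; positivity, ?_⟩
  intro R hR Γ DΓ hder hc0 hc1 hskew β hβ u hu Rt hRt
  have hCn : Conn (closedCylinder n (2 * R) R) Γ DΓ :=
    ⟨isCompact_closedCylinder _ _, convex_closedCylinder _ _, hder, hc0, hc1, hskew⟩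
  obtain ⟨κ, hκd⟩ : ∃ κ, κ = β - 1 / R ^ 2 := ⟨_, rfl⟩
  have hκ : 0 ≤ κ := by
    have h := hβ 0 (mem_ball_self (by positivity)) (R / 2) ⟨by positivity, by linarith⟩
      (EuclideanSpace.single 0 1) (EuclideanSpace.single 0 1)
    rw [← hκd] at h
    have h2 := (norm_nonneg _).trans h
    simpa using h2
  have hβκ : κ < β := by
    have : 0 < 1 / R ^ 2 := by positivity
    linarith
  have hβ0 : 0 < β := by linarith
  have hK : ∀ z ∈ openCylinder n (2 * R) R, ∀ v w, ‖curv Γ DΓ z v w‖ ≤ κ * ‖v‖ * ‖w‖ := by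
    rintro z ⟨x, hx, t, ht, rfl⟩ v w
    rw [hκd]
    exact hβ x hx t ht v w
  obtain ⟨DR, hHT⟩ := exists_HT hR hκ hCn hK hRt
  obtain ⟨g, Dg, hVT⟩ := exists_VT hR hκ hCn hK
  have huc : ContinuousOn u (ball 0 (2 * R)) := hu.continuousOn.mono ball_subset_closedBall
  obtain ⟨c, hcd⟩ : ∃ c, c = √β := ⟨_, rfl⟩
  have hc : 0 < c := by rw [hcd]; exact Real.sqrt_pos.2 hβ0
  have hc2 : c ^ 2 = β := by rw [hcd]; exact Real.sq_sqrt hβ0.le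
  have hκc : κ ≤ c ^ 2 := by rw [hc2]; exact hβκ.le
  have hcβ : ∀ e : ℝ, β ^ (e / 2) = c ^ e := by
    intro e
    rw [← hc2, ← Real.rpow_natCast c 2, ← Real.rpow_mul hc.le]
    congr 1; push_cast; ring
  have hR2 : ball (0 : EuclideanSpace ℝ (Fin n)) R ⊆ ball 0 (2 * R) :=
    ball_subset_ball (by linarith)
  refine ⟨Uf c g Rt u, DUf R c g Dg Rt DR u, fun z hz => Uf_hasFDerivAt hR hHT hVT huc hz,
    DUf_cont hR hHT hVT huc, Uf_cont hR hHT hVT huc,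
    fun x hx => Uf_bottom hHT hVT (hR2 hx), ?_, ?_⟩
  · rw [← hbd, ← had]
    have h := est1 (n := n) (p := p) (s := s) (b := b) (c := c) (K := K) (R := R) (a := a) hp hs0
      hbd had hb hc hK0 (f := fun y => ‖u y‖) huc.norm (fun y => norm_nonneg _)
      (k := fun x y => ‖u x - Rt x y (u y)‖)
      (fun x hx => by
        refine (continuousOn_const.sub ?_).norm
        have h0 : ContinuousOn (fun y => Rt x y) (ball 0 (2 * R)) :=
          hHT.c0.comp (f := fun y => (x, y)) (by fun_prop) (fun y hy => ⟨hR2 hx, hy⟩)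
        exact h0.clm_apply huc)
      (fun x y => norm_nonneg _)
      (fun x hx => by
        show ‖u x - Rt x x (u x)‖ = 0
        rw [hHT.diag x (hR2 hx)]; simp)
      (H := fun x t => hsNorm (DUf R c g Dg Rt DR u (emb x t) +
        (Γ (emb x t)).flip (Uf c g Rt u (emb x t))))
      (fun x t => hsNorm_nonneg _)
      (fun x hx t ht => by
        have ht0 := ht.1
        have hz : emb x t ∈ openCylinder n R R := ⟨x, hx, t, ht, rfl⟩
        have hB := DUf_bound hR hHT hVT huc hκ hc hκc hM0 hM hMt0 hMt hz
        rw [px_emb, pt_emb] at hB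
        have hI1 : 0 ≤ ∫ y in closedBall x (t/2), ‖u x - Rt x y (u y)‖ :=
          integral_nonneg fun y => norm_nonneg _
        have hI2 : 0 ≤ ∫ y in closedBall x (t/2), ‖u y‖ :=
          integral_nonneg fun y => norm_nonneg _
        have hι : (0:ℝ) ≤ (if c * t ≤ 1 then c else 0) := by split_ifs <;> linarith
        refine (hsNorm_le _ ?_ hB).trans (le_of_eq ?_)
        · positivity
        · rw [hKd]; ring)
    refine h.trans ?_
    rw [← hA1]
    have hcc : c ^ p * c ^ (-b) = β ^ (s * p / 2) := by
      rw [hcβ, ← Real.rpow_add hc]; congr 1; rw [hbd]; ring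
    have e1 : ENNReal.ofReal A1 * ENNReal.ofReal (1 / a) ≤ ENNReal.ofReal C := by
      rw [← ENNReal.ofReal_mul hA10]
      exact ENNReal.ofReal_le_ofReal (by rw [hC]; linarith)
    have e2 : ENNReal.ofReal A1 * (ENNReal.ofReal (c ^ p) * (ENNReal.ofReal (om n) *
        ENNReal.ofReal (c ^ (-b) / b))) ≤ ENNReal.ofReal C * ENNReal.ofReal (β ^ (s * p / 2)) := by
      rw [← ENNReal.ofReal_mul hom, ← ENNReal.ofReal_mul (by positivity),
        ← ENNReal.ofReal_mul hA10, ← ENNReal.ofReal_mul' (by positivity)]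
      refine ENNReal.ofReal_le_ofReal ?_
      rw [← hcc]
      have : A1 * (c ^ p * (om n * (c ^ (-b) / b))) = A1 * om n / b * (c ^ p * c ^ (-b)) := by ring
      rw [this]
      gcongr
      rw [hC]; linarith
    rw [mul_add, mul_add, ← mul_assoc, ← mul_assoc (ENNReal.ofReal C)]
    refine add_le_add (mul_le_mul_left e1 _) ?_
    rw [← mul_assoc, ← mul_assoc]
    refine mul_le_mul_left ?_ _
    rw [mul_assoc]
    exact e2
  · rw [← hbd]
    have h := est2 (n := n) (p := p) (b := b) (c := c) (M := M) (R := R) hp hb hc hM0.le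
      (f := fun y => ‖u y‖) huc.norm (fun y => norm_nonneg _)
      (H := fun x t => ‖Uf c g Rt u (emb x t)‖) (fun x t => norm_nonneg _)
      (fun x hx t ht => by
        have hz : emb x t ∈ openCylinder n R R := ⟨x, hx, t, ht, rfl⟩
        have hB := Uf_bound (c := c) hR hHT hVT huc hM hz
        rwa [px_emb, pt_emb] at hB)
    refine h.trans ?_
    rw [← hA2, ← mul_assoc]
    refine mul_le_mul_left ?_ _
    rw [← ENNReal.ofReal_mul hom, ← ENNReal.ofReal_mul hA20]
    refine ENNReal.ofReal_le_ofReal ?_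
    rw [hcβ, Real.rpow_neg hc.le]
    have : A2 * (om n * ((c ^ b)⁻¹ / b)) = A2 * om n / b / c ^ b := by
      rw [div_eq_mul_inv _ (c ^ b)]; ring
    rw [this]
    gcongr
    rw [hC]; linarith
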